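/- arXiv:2104.07443 — 2 statements merged into one kernel-verified Lean document; each statement's English description precedes it below -/
import Mathlib

section
/- Let f : ℕ → ℂ be in the class F₁ and let k ≥ 3 be a fixed integer. Then Σ_{n₁,…,n_k ≤ x} f(gcd(n₁,…,n_k)) = D_{f,k}·x^k + R(x), where D_{f,k} = Σ_p (1 − 1/p^k)·Σ_{ν=1}^{∞} f(p^ν)/p^{νk} (the sum over all primes, absolutely convergent), and where R(x) = O(x^{k−1}) as x → ∞ if k ≥ 4, and R(x) = O(x²·log log x) as x → ∞ if k = 3. -/
lemma aux_block (j : ℕ) (hj : 1 ≤ j) :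
    ∑ p ∈ (Finset.Ico (2 ^ j) (2 ^ (j+1))).filter Nat.Prime, (1 / (p : ℝ)) ≤ 4 / j := by
  set S := (Finset.Ico (2 ^ j) (2 ^ (j+1))).filter Nat.Prime with hS
  have h1 : (2 ^ j) ^ S.card ≤ 4 ^ (2 ^ (j+1)) := by
    calc (2 ^ j) ^ S.card ≤ ∏ p ∈ S, p := by
          apply Finset.pow_card_le_prod
          intro p hp
          simp [hS] at hp
          exact hp.1.1
      _ ≤ primorial (2 ^ (j+1)) := by
          unfold primorial
          apply Finset.prod_le_prod_of_subset_of_one_le'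
          · intro p hp
            simp [hS] at hp
            simp
            exact ⟨by omega, hp.2⟩
          · intro i hi _
            simp at hi
            exact hi.2.one_lt.le
      _ ≤ _ := primorial_le_four_pow _
  have h2 : j * S.card ≤ 2 * 2 ^ (j+1) := by
    rw [← pow_mul, show (4:ℕ) = 2 ^ 2 by norm_num, ← pow_mul] at h1
    exact (Nat.pow_le_pow_iff_right (by norm_num)).1 h1
  have h3 : ∑ p ∈ S, (1 / (p : ℝ)) ≤ S.card • (1 / (2:ℝ) ^ j) := by
    apply Finset.sum_le_card_nsmul
    intro p hp
    simp only [hS, Finset.mem_filter, Finset.mem_Ico] at hp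
    apply one_div_le_one_div_of_le (by positivity)
    exact_mod_cast hp.1.1
  refine h3.trans ?_
  have h4 : (j : ℝ) * S.card ≤ 2 * 2 ^ (j+1) := by exact_mod_cast h2
  have hj' : (0:ℝ) < j := by exact_mod_cast hj
  rw [nsmul_eq_mul, mul_one_div, div_le_div_iff₀ (by positivity) hj']
  rw [pow_succ] at h4
  linarith

lemma aux_mertens (J : ℕ) :
    ∑ p ∈ (Finset.range (2 ^ (J+1))).filter Nat.Prime, (1 / (p : ℝ)) ≤ 4 * (harmonic J : ℝ) := by
  induction J with
  | zero =>
    have : (Finset.range (2 ^ (0+1))).filter Nat.Prime = ∅ := by decide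
    rw [this]; simp
  | succ J ih =>
    have h := aux_block (J+1) (by omega)
    have hle : 2 ^ (J+1) ≤ 2 ^ (J+1+1) := Nat.pow_le_pow_right (by norm_num) (by omega)
    rw [Finset.sum_filter] at *
    rw [← Finset.sum_range_add_sum_Ico _ hle, harmonic_succ]
    push_cast at *
    rw [mul_add]
    apply add_le_add ih
    simpa [div_eq_mul_inv] using h

lemma aux_mertens' (x : ℝ) (hx : 3 ≤ x) :
    ∑ p ∈ (Finset.range (⌊x⌋₊ + 1)).filter Nat.Prime, (1 / (p : ℝ)) ≤
      8 + 4 * Real.log (Real.log x) := by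
  set N := ⌊x⌋₊
  have hN : 3 ≤ N := Nat.le_floor (by simpa using hx)
  set J := Nat.log 2 N
  have h1 : N < 2 ^ (J+1) := Nat.lt_pow_succ_log_self (by norm_num) N
  have h2 : 2 ^ J ≤ N := Nat.pow_log_le_self 2 (by omega)
  have hJ : 1 ≤ J := Nat.log_pos (by norm_num) (by omega)
  have h3 : (2:ℝ) ^ J ≤ x := le_trans (by exact_mod_cast h2) (Nat.floor_le (by linarith))
  have h4 : J * Real.log 2 ≤ Real.log x := by
    rw [← Real.log_pow]; exact Real.log_le_log (by positivity) h3
  have hl2 := Real.log_two_gt_d9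
  have h5 : (J:ℝ) ≤ 2 * Real.log x := by
    have : (0:ℝ) ≤ J := by positivity
    nlinarith
  have hJ' : (0:ℝ) < J := by exact_mod_cast hJ
  have hlx : 0 < Real.log x := Real.log_pos (by linarith)
  have h6 : Real.log J ≤ 1 + Real.log (Real.log x) := by
    refine (Real.log_le_log hJ' h5).trans ?_
    rw [Real.log_mul (by norm_num) hlx.ne']
    have := Real.log_two_lt_d9
    linarith
  have h7 := harmonic_le_one_add_log J
  have h8 := aux_mertens J
  refine le_trans ?_ (h8.trans (by linarith))
  apply Finset.sum_le_sum_of_subset_of_nonneg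
  · apply Finset.filter_subset_filter
    simpa using h1
  · intros; positivity

lemma aux_loglog : ∃ d > (0:ℝ), ∀ x : ℝ, 3 ≤ x → d ≤ Real.log (Real.log x) := by
  have h3 : 1 < Real.log 3 := by
    rw [Real.lt_log_iff_exp_lt (by norm_num)]
    have := Real.exp_one_lt_d9
    linarith
  refine ⟨Real.log (Real.log 3), Real.log_pos h3, fun x hx => ?_⟩
  exact Real.log_le_log (by linarith) (Real.log_le_log (by norm_num) hx)

lemma aux_floor (y : ℝ) (hy : 0 ≤ y) (k : ℕ) :
    |(⌊y⌋₊ : ℝ) ^ k - y ^ k| ≤ k * y ^ (k-1) := by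
  refine (abs_pow_sub_pow_le _ _ _).trans ?_
  have h1 := Nat.floor_le hy
  have h2 := Nat.lt_floor_add_one y
  rw [abs_of_nonneg (Nat.cast_nonneg ⌊y⌋₊ : (0:ℝ) ≤ _), abs_of_nonneg hy, max_eq_right h1]
  have : |(⌊y⌋₊ : ℝ) - y| ≤ 1 := by rw [abs_le]; constructor <;> linarith
  gcongr
  nlinarith [(Nat.cast_nonneg k : (0:ℝ) ≤ k)]

lemma aux_count (N q k : ℕ) :
    ((Fintype.piFinset (fun _ : Fin k => Finset.Icc 1 N)).filter
      (fun n => q ∣ Finset.univ.gcd n)).card = (N / q) ^ k := by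
  have : (Fintype.piFinset (fun _ : Fin k => Finset.Icc 1 N)).filter
      (fun n => q ∣ Finset.univ.gcd n) =
      Fintype.piFinset (fun _ : Fin k => (Finset.Ioc 0 N).filter (q ∣ ·)) := by
    ext n
    simp [Finset.dvd_gcd_iff, Nat.succ_le_iff, forall_and]
  rw [this, Fintype.card_piFinset]
  simp [Nat.Ioc_filter_dvd_card_eq_div]

lemma aux_f (f : ℕ → ℂ)
    (hadd : ∀ m n : ℕ, Nat.Coprime m n → f (m * n) = f m + f n) (N m : ℕ) (hm : m ≠ 0)
    (hmN : m ≤ N) :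
    f m = ∑ p ∈ (Finset.range (N+1)).filter Nat.Prime, ∑ ν ∈ Finset.range N,
      if p ^ (ν+1) ∣ m then (f (p ^ (ν+1)) - f (p ^ ν)) else 0 := by
  have hf1 : f 1 = 0 := by simpa using hadd 1 1 (by simp)
  have h := Nat.multiplicative_factorization (fun n => Multiplicative.ofAdd (f n))
    (fun x y hxy => by simp [hadd x y hxy]) (by simp [hf1]) hm
  have h' : f m = m.factorization.sum fun p k => f (p ^ k) := by
    apply Multiplicative.ofAdd.injective
    rw [h, Finsupp.prod, Finsupp.sum, ofAdd_sum]
  have hin : ∀ p ∈ (Finset.range (N+1)).filter Nat.Prime, (∑ ν ∈ Finset.range N,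
      if p ^ (ν+1) ∣ m then (f (p ^ (ν+1)) - f (p ^ ν)) else 0) = f (p ^ m.factorization p) := by
    intro p hp
    simp at hp
    have : ∀ ν, p ^ (ν+1) ∣ m ↔ ν < m.factorization p := fun ν => by
      rw [hp.2.pow_dvd_iff_le_factorization hm]; omega
    simp_rw [this]
    rw [← Finset.sum_filter]
    have h2 : (Finset.range N).filter (· < m.factorization p) = Finset.range (m.factorization p) := by
      ext ν
      have := Nat.factorization_lt p hm
      simp; omega
    rw [h2, Finset.sum_range_sub (fun i => f (p ^ i))]
    simp [hf1]
  rw [Finset.sum_congr rfl hin, h', Finsupp.sum]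
  apply Finset.sum_subset
  · intro p hp
    simp at hp
    simp
    exact ⟨by have := Nat.le_of_dvd (by omega) hp.2.1; omega, hp.1⟩
  · intro p _ hp
    rw [Finsupp.notMem_support_iff.1 hp]; simp [hf1]

lemma aux_sum (f : ℕ → ℂ)
    (hadd : ∀ m n : ℕ, Nat.Coprime m n → f (m * n) = f m + f n) (k : ℕ) (hk : k ≠ 0) (N : ℕ) :
    (∑ n ∈ Fintype.piFinset (fun _ : Fin k => Finset.Icc 1 N), f (Finset.univ.gcd n)) =
    ∑ p ∈ (Finset.range (N+1)).filter Nat.Prime, ∑ ν ∈ Finset.range N,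
      (f (p ^ (ν+1)) - f (p ^ ν)) * ((N / p ^ (ν+1) : ℕ) : ℂ) ^ k := by
  have h1 : ∀ n ∈ Fintype.piFinset (fun _ : Fin k => Finset.Icc 1 N), f (Finset.univ.gcd n) =
     ∑ p ∈ (Finset.range (N+1)).filter Nat.Prime, ∑ ν ∈ Finset.range N,
      if p ^ (ν+1) ∣ Finset.univ.gcd n then (f (p ^ (ν+1)) - f (p ^ ν)) else 0 := by
    intro n hn
    simp at hn
    let i : Fin k := ⟨0, by omega⟩
    have hd : Finset.univ.gcd n ∣ n i := Finset.gcd_dvd (Finset.mem_univ i)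
    have hi := hn i
    have hne : Finset.univ.gcd n ≠ 0 := fun h => by
      rw [h] at hd; have := Nat.eq_zero_of_zero_dvd hd; omega
    exact aux_f f hadd N _ hne (by have := Nat.le_of_dvd (by omega) hd; omega)
  rw [Finset.sum_congr rfl h1, Finset.sum_comm]
  refine Finset.sum_congr rfl fun p _ => ?_
  rw [Finset.sum_comm]
  refine Finset.sum_congr rfl fun ν _ => ?_
  rw [← Finset.sum_filter, Finset.sum_const, aux_count, nsmul_eq_mul, mul_comm]
  simp

lemma aux_tsum (f : ℕ → ℂ)
    (hadd : ∀ m n : ℕ, Nat.Coprime m n → f (m * n) = f m + f n) (k : ℕ) (hk : k ≠ 0) (N : ℕ) :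
    HasSum (fun i : Nat.Primes × ℕ => (f (i.1 ^ (i.2+1)) - f (i.1 ^ i.2)) *
      ((N / (i.1:ℕ) ^ (i.2+1) : ℕ) : ℂ) ^ k)
     (∑ n ∈ Fintype.piFinset (fun _ : Fin k => Finset.Icc 1 N), f (Finset.univ.gcd n)) := by
  rw [aux_sum f hadd k hk N]
  set F : ℕ → ℕ → ℂ := fun p ν => (f (p ^ (ν+1)) - f (p ^ ν)) * ((N / p ^ (ν+1) : ℕ) : ℂ) ^ k
    with hF
  have h1 : ∑ p ∈ (Finset.range (N+1)).filter Nat.Prime, ∑ ν ∈ Finset.range N, F p ν =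
    ∑ i ∈ ((Finset.range (N+1)).subtype Nat.Prime) ×ˢ Finset.range N, F i.1 i.2 := by
    rw [Finset.sum_product, Finset.sum_subtype_eq_sum_filter (fun p => ∑ ν ∈ Finset.range N, F p ν)]
  rw [h1]
  apply hasSum_sum_of_ne_finset_zero
  rintro ⟨p, ν⟩ hi
  have h2 : N < (p:ℕ) ^ (ν+1) := by
    by_contra hcon
    push Not at hcon
    apply hi
    have hp := p.2
    have h3 : (p:ℕ) ≤ p ^ (ν+1) := Nat.le_self_pow (by omega) _
    have h4 : ν + 1 < p ^ (ν+1) := Nat.lt_pow_self p.2.one_lt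
    exact Finset.mem_product.2 ⟨Finset.mem_subtype.2 (Finset.mem_range.2
      (Nat.lt_succ_of_le (h3.trans hcon))), Finset.mem_range.2 (by simp only; omega)⟩
  simp [Nat.div_eq_of_lt h2, hk]

lemma aux_bound (f : ℕ → ℂ)
    (hadd : ∀ m n : ℕ, Nat.Coprime m n → f (m * n) = f m + f n)
    (hp1 : ∀ p : ℕ, p.Prime → f p = (p : ℂ))
    (hbound : ∃ (l : ℕ) (K : ℝ), ∀ p : ℕ, p.Prime → ∀ ν : ℕ, 2 ≤ ν →
      ‖f (p ^ ν)‖ ≤ K * (ν : ℝ) ^ l * (p : ℝ) ^ ν) :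
    ∃ (l : ℕ) (C : ℝ), 0 ≤ C ∧ ∀ p : ℕ, p.Prime → ∀ ν : ℕ,
      ‖f (p ^ (ν+1))‖ ≤ C * ((ν:ℝ)+1) ^ l * (p : ℝ) ^ (ν+1) ∧
      ‖f (p ^ (ν+1)) - f (p ^ ν)‖ ≤ C * ((ν:ℝ)+1) ^ l * (p : ℝ) ^ (ν+1) := by
  have hf1 : f 1 = 0 := by simpa using hadd 1 1 (by simp)
  obtain ⟨l, K, hK⟩ := hbound
  have hC : (0:ℝ) ≤ |K| + 1 := by positivity
  have key : ∀ p : ℕ, p.Prime → ∀ ν : ℕ,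
      ‖f (p ^ (ν+1))‖ ≤ (|K|+1) * ((ν:ℝ)+1) ^ l * (p : ℝ) ^ (ν+1) := by
    intro p hp ν
    rcases Nat.eq_zero_or_pos ν with rfl | hν
    · simp [hp1 p hp]
      nlinarith [abs_nonneg K, (Nat.cast_nonneg p : (0:ℝ) ≤ p)]
    · refine (hK p hp (ν+1) (by omega)).trans ?_
      push_cast
      gcongr
      linarith [le_abs_self K]
  refine ⟨l, 2 * (|K|+1), by positivity, fun p hp ν => ?_⟩
  have h1 := key p hp ν
  have hnn : 0 ≤ (|K|+1) * ((ν:ℝ)+1) ^ l * (p : ℝ) ^ (ν+1) := by positivity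
  refine ⟨by nlinarith, ?_⟩
  have h2 : ‖f (p ^ ν)‖ ≤ (|K|+1) * ((ν:ℝ)+1) ^ l * (p : ℝ) ^ (ν+1) := by
    rcases ν with _ | μ
    · simpa [hf1] using hnn
    · refine (key p hp μ).trans ?_
      have : (1:ℝ) ≤ p := by exact_mod_cast hp.one_lt.le
      push_cast
      gcongr
      · linarith
      · omega
  refine (norm_sub_le _ _).trans ?_
  linarith

lemma aux_sumprime : Summable (fun p : Nat.Primes => 1 / ((p:ℕ):ℝ) ^ 2) :=
  (Real.summable_one_div_nat_pow.2 (by norm_num : 1 < 2)).comp_injective Subtype.val_injective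

lemma aux_geom (l : ℕ) (r : ℝ) (hr0 : 0 < r) (hr : r < 1) (c : ℕ) :
    Summable (fun ν : ℕ => ((ν:ℝ) + c) ^ l * r ^ ν) := by
  have h := summable_pow_mul_geometric_of_norm_lt_one (R := ℝ) l (r := r)
    (by rw [Real.norm_eq_abs, abs_of_pos hr0]; exact hr)
  have h2 := ((summable_nat_add_iff c).2 h).mul_right ((r ^ c)⁻¹)
  refine h2.congr fun ν => ?_
  push_cast
  rw [pow_add]
  field_simp

lemma aux_summ3 (l : ℕ) (C : ℝ) (s : ℕ) (hs : 3 ≤ s) (a : Nat.Primes × ℕ → ℝ)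
    (ha0 : ∀ i, 0 ≤ a i)
    (ha : ∀ i : Nat.Primes × ℕ, a i ≤ C * ((i.2:ℝ)+1) ^ l * ((i.1:ℕ):ℝ) ^ (i.2+1)) (hC : 0 ≤ C) :
    Summable (fun i : Nat.Primes × ℕ => a i / ((i.1:ℕ):ℝ) ^ ((i.2+1) * s)) := by
  have h := (aux_sumprime.mul_of_nonneg (aux_geom l (1/4) (by norm_num) (by norm_num) 1)
    (fun _ => by positivity) (fun _ => by positivity)).mul_left C
  refine Summable.of_nonneg_of_le (fun i => div_nonneg (ha0 i) (by positivity)) (fun i => ?_) h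
  obtain ⟨p, ν⟩ := i
  have hp : (2:ℝ) ≤ ((p:ℕ):ℝ) := by exact_mod_cast p.2.two_le
  have hp0 : (0:ℝ) < ((p:ℕ):ℝ) := by linarith
  refine (div_le_div_of_nonneg_right (ha (p,ν)) (by positivity)).trans ?_
  simp only
  generalize ((p:ℕ):ℝ) = P at *
  have h1 : P ^ (ν+1) * (P^2 * 4 ^ ν) ≤ P ^ ((ν+1)*s) := by
    calc P ^ (ν+1) * (P^2 * 4 ^ ν) ≤ P ^ (ν+1) * (P^2 * (P^2) ^ ν) := by gcongr; nlinarith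
      _ = P ^ ((ν+1)*3) := by ring
      _ ≤ _ := pow_le_pow_right₀ (by linarith) (by gcongr)
  rw [div_le_iff₀ (by positivity)]
  calc C * ((ν:ℝ)+1)^l * P ^ (ν+1) 
      = C * ((1 / P^2) * ((ν + 1)^l * (1/4)^ν)) * (P ^ (ν+1) * (P^2 * 4 ^ ν)) := by
        rw [one_div_pow]; field_simp
    _ ≤ _ := by push_cast; gcongr

lemma aux_summ2 (l : ℕ) (C : ℝ) (a : Nat.Primes × ℕ → ℝ)
    (ha0 : ∀ i, 0 ≤ a i)
    (ha : ∀ i : Nat.Primes × ℕ, a i ≤ C * ((i.2:ℝ)+1) ^ l * ((i.1:ℕ):ℝ) ^ (i.2+1)) (hC : 0 ≤ C) :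
    Summable (fun i : Nat.Primes × ℕ => if i.2 = 0 then 0 else
      a i / ((i.1:ℕ):ℝ) ^ ((i.2+1) * 2)) := by
  have hinj : Function.Injective (fun i : Nat.Primes × ℕ => ((i.1, i.2+1) : Nat.Primes × ℕ)) := by
    rintro ⟨a, b⟩ ⟨c, d⟩ h
    simpa using h
  rw [← hinj.summable_iff]
  swap
  · rintro ⟨p, ν⟩ hi
    rcases ν with _ | ν
    · simp
    · exact absurd ⟨(p, ν), rfl⟩ hi
  have h := (aux_sumprime.mul_of_nonneg (aux_geom l (1/2) (by norm_num) (by norm_num) 2)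
    (fun _ => by positivity) (fun _ => by positivity)).mul_left C
  refine Summable.of_nonneg_of_le (fun i => ?_) (fun i => ?_) h
  · simp only [Function.comp]
    rw [if_neg (by omega)]
    exact div_nonneg (ha0 _) (by positivity)
  obtain ⟨p, ν⟩ := i
  have hp : (2:ℝ) ≤ ((p:ℕ):ℝ) := by exact_mod_cast p.2.two_le
  have hp0 : (0:ℝ) < ((p:ℕ):ℝ) := by linarith
  simp only [Function.comp]
  rw [if_neg (by omega)]
  refine (div_le_div_of_nonneg_right (ha (p,ν+1)) (by positivity)).trans ?_
  simp only
  generalize ((p:ℕ):ℝ) = P at *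
  have h1 : P ^ (ν+1+1) * (P^2 * 2 ^ ν) ≤ P ^ ((ν+1+1)*2) := by
    calc P ^ (ν+1+1) * (P^2 * 2 ^ ν) ≤ P ^ (ν+1+1) * (P^2 * P ^ ν) := by gcongr
      _ = P ^ ((ν+1+1)*2) := by ring
  rw [div_le_iff₀ (by positivity)]
  calc C * (((ν+1:ℕ):ℝ)+1)^l * P ^ (ν+1+1) 
      = C * ((1 / P^2) * ((ν + 2)^l * (1/2)^ν)) * (P ^ (ν+1+1) * (P^2 * 2 ^ ν)) := by
        rw [one_div_pow]; push_cast; rw [show (ν:ℝ)+1+1 = ν+2 by ring]; field_simp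
    _ ≤ _ := by push_cast; gcongr

lemma aux_tele (u : ℕ → ℂ) (hu : u 0 = 0) (r : ℂ) (h : Summable (fun ν => u (ν+1) * r ^ (ν+1))) :
    (1 - r) * ∑' ν, u (ν+1) * r ^ (ν+1) = ∑' ν, (u (ν+1) - u ν) * r ^ (ν+1) := by
  have h0 : Summable (fun ν => u ν * r ^ ν) := (summable_nat_add_iff 1).1 h
  have h1 : ∑' ν, u ν * r ^ ν = ∑' ν, u (ν+1) * r ^ (ν+1) := by
    rw [h0.tsum_eq_zero_add]; simp [hu]
  have h2 : ∑' ν, u ν * r ^ (ν+1) = r * ∑' ν, u (ν+1) * r ^ (ν+1) := by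
    rw [← h1, ← tsum_mul_left]
    congr 1; ext ν; ring
  have h3 : Summable (fun ν => u ν * r ^ (ν+1)) := (h0.mul_left r).congr fun ν => by ring
  simp_rw [sub_mul]
  rw [h.tsum_sub h3, h2, one_mul]

lemma aux_tail (N : ℕ) : ∃ T ≤ 2 / ((N:ℝ)+1),
    HasSum (fun p : Nat.Primes => if (p:ℕ) ≤ N then (0:ℝ) else 1 / ((p:ℕ):ℝ)^2) T := by
  have hnn : ∀ n : ℕ, 0 ≤ (if n ≤ N then (0:ℝ) else 1 / (n:ℝ)^2) := by
    intro n; split_ifs <;> positivity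
  have hs : Summable (fun n : ℕ => if n ≤ N then (0:ℝ) else 1 / (n:ℝ)^2) := by
    refine Summable.of_nonneg_of_le (fun n => ?_) (fun n => ?_)
      (Real.summable_one_div_nat_pow.2 (by norm_num : 1 < 2))
    · split_ifs <;> positivity
    · split_ifs
      · positivity
      · rfl
  have hp : Summable (fun p : Nat.Primes => if (p:ℕ) ≤ N then (0:ℝ) else 1 / ((p:ℕ):ℝ)^2) :=
    hs.comp_injective (i := fun p : Nat.Primes => (p:ℕ)) Subtype.val_injective
  refine ⟨_, ?_, hp.hasSum⟩
  have h1 := Summable.tsum_le_tsum_of_inj (fun p : Nat.Primes => (p:ℕ)) Subtype.val_injective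
    (fun n _ => hnn n) (fun p => le_refl _) hp hs
  refine le_trans h1 ?_
  refine Real.tsum_le_of_sum_range_le hnn fun n => ?_
  refine le_trans (le_of_eq ?_) (sum_Ioo_inv_sq_le N n)
  have : Finset.Ioo N n = (Finset.range n).filter (fun i => ¬ i ≤ N) := by
    ext; simp; omega
  rw [this, Finset.sum_filter]
  refine Finset.sum_congr rfl fun i _ => ?_
  by_cases h : i ≤ N <;> simp [h]


/-- **Gcd sums for the class `F₁`, `k ≥ 3`** (Theorem `Th_f_additive_gcd_1`, case `k ≥ 3`).
`F₁` is the class of additive `f : ℕ → ℂ` with `f p = p` for every prime `p` and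
`|f (p^ν)| ≤ K ν^ℓ p^ν` uniformly for primes `p` and `ν ≥ 2`. For `f ∈ F₁` and
fixed `k ≥ 3`: `Σ_{n₁,…,n_k ≤ x} f (gcd(n₁,…,n_k)) = D_{f,k} x^k + R(x)`, where
`D_{f,k} = Σ_p (1 − 1/p^k) Σ_{ν ≥ 1} f(p^ν)/p^{νk}` (absolutely convergent sum over
primes), `R(x) = O(x^{k−1})` if `k ≥ 4` and `R(x) = O(x² log log x)` if `k = 3`. -/
theorem stmt_15 (f : ℕ → ℂ)
    (hadd : ∀ m n : ℕ, Nat.Coprime m n → f (m * n) = f m + f n)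
    (hp1 : ∀ p : ℕ, p.Prime → f p = (p : ℂ))
    (hbound : ∃ (l : ℕ) (K : ℝ), ∀ p : ℕ, p.Prime → ∀ ν : ℕ, 2 ≤ ν →
      ‖f (p ^ ν)‖ ≤ K * (ν : ℝ) ^ l * (p : ℝ) ^ ν)
    (k : ℕ) (hk : 3 ≤ k) :
    Summable (fun p : Nat.Primes =>
      ‖(1 - 1 / ((p : ℕ) : ℂ) ^ k) *
        ∑' ν : ℕ, f ((p : ℕ) ^ (ν + 1)) / ((p : ℕ) : ℂ) ^ ((ν + 1) * k)‖) ∧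
    ((4 ≤ k →
      ∃ c > (0 : ℝ), ∃ x₀ : ℝ, 3 ≤ x₀ ∧ ∀ x ≥ x₀,
        ‖(∑ n ∈ Fintype.piFinset (fun _ : Fin k => Finset.Icc 1 ⌊x⌋₊),
            f (Finset.univ.gcd n)) -
          (∑' p : Nat.Primes, (1 - 1 / ((p : ℕ) : ℂ) ^ k) *
              ∑' ν : ℕ, f ((p : ℕ) ^ (ν + 1)) / ((p : ℕ) : ℂ) ^ ((ν + 1) * k)) *
            (x : ℂ) ^ k‖ ≤ c * x ^ (k - 1)) ∧
     (k = 3 →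
      ∃ c > (0 : ℝ), ∃ x₀ : ℝ, 3 ≤ x₀ ∧ ∀ x ≥ x₀,
        ‖(∑ n ∈ Fintype.piFinset (fun _ : Fin k => Finset.Icc 1 ⌊x⌋₊),
            f (Finset.univ.gcd n)) -
          (∑' p : Nat.Primes, (1 - 1 / ((p : ℕ) : ℂ) ^ k) *
              ∑' ν : ℕ, f ((p : ℕ) ^ (ν + 1)) / ((p : ℕ) : ℂ) ^ ((ν + 1) * k)) *
            (x : ℂ) ^ k‖ ≤ c * x ^ 2 * Real.log (Real.log x))) := by
  have hf1 : f 1 = 0 := by simpa using hadd 1 1 (by simp)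
  obtain ⟨l, C, hC, hb⟩ := aux_bound f hadd hp1 hbound
  set a : Nat.Primes × ℕ → ℂ := fun i => f ((i.1:ℕ) ^ (i.2+1)) - f ((i.1:ℕ) ^ i.2) with ha
  have hab : ∀ i : Nat.Primes × ℕ, ‖a i‖ ≤ C * ((i.2:ℝ)+1) ^ l * ((i.1:ℕ):ℝ) ^ (i.2+1) :=
    fun i => (hb i.1 i.1.2 i.2).2
  have hfb : ∀ i : Nat.Primes × ℕ, ‖f ((i.1:ℕ) ^ (i.2+1))‖ ≤
      C * ((i.2:ℝ)+1) ^ l * ((i.1:ℕ):ℝ) ^ (i.2+1) :=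
    fun i => (hb i.1 i.1.2 i.2).1
  have hsa : ∀ s, 3 ≤ s → Summable (fun i : Nat.Primes × ℕ => ‖a i‖ / ((i.1:ℕ):ℝ) ^ ((i.2+1) * s)) :=
    fun s hs => aux_summ3 l C s hs _ (fun _ => norm_nonneg _) hab hC
  have hsf := aux_summ3 l C k hk (fun i => ‖f ((i.1:ℕ) ^ (i.2+1))‖) (fun _ => norm_nonneg _) hfb hC
  have hsa' : Summable (fun i : Nat.Primes × ℕ => ‖a i / ((i.1:ℕ):ℂ) ^ ((i.2+1) * k)‖) := by
    refine (hsa k hk).congr fun i => ?_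
    simp
  -- the inner identity
  have hinner : ∀ p : Nat.Primes, (1 - 1 / ((p : ℕ) : ℂ) ^ k) *
        ∑' ν : ℕ, f ((p : ℕ) ^ (ν + 1)) / ((p : ℕ) : ℂ) ^ ((ν + 1) * k) =
        ∑' ν : ℕ, a (p, ν) / ((p:ℕ):ℂ) ^ ((ν+1) * k) := by
    intro p
    have hr : ∀ (z : ℂ) (ν : ℕ), z / ((p : ℕ) : ℂ) ^ ((ν + 1) * k) =
        z * (1 / ((p : ℕ) : ℂ) ^ k) ^ (ν+1) := by
      intro z ν
      rw [one_div_pow, ← pow_mul, mul_comm (ν+1) k, mul_one_div]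
    simp_rw [hr]
    refine aux_tele (fun ν => f ((p:ℕ) ^ ν)) (by simp [hf1]) _ ?_
    have h1 := hsf.prod_factor p
    refine Summable.of_norm (h1.congr fun ν => ?_)
    rw [← hr]
    simp
  simp_rw [hinner]
  have hD := hsa'.of_norm.tsum_prod
  have hE : ∀ x : ℝ, 3 ≤ x → HasSum (fun i : Nat.Primes × ℕ =>
      a i * ((((⌊x / ((i.1:ℕ):ℝ) ^ (i.2+1)⌋₊ : ℝ) ^ k -
        (x / ((i.1:ℕ):ℝ) ^ (i.2+1)) ^ k : ℝ)) : ℂ))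
      ((∑ n ∈ Fintype.piFinset (fun _ : Fin k => Finset.Icc 1 ⌊x⌋₊),
            f (Finset.univ.gcd n)) -
          (∑' p : Nat.Primes, ∑' ν : ℕ, a (p, ν) / ((p:ℕ):ℂ) ^ ((ν+1) * k)) * (x : ℂ) ^ k) := by
    intro x hx
    rw [← hD]
    have h1 := aux_tsum f hadd k (by omega) ⌊x⌋₊
    have h2 := hsa'.of_norm.hasSum.mul_right ((x:ℂ)^k)
    refine (h1.sub h2).congr_fun ?_
    intro i
    have : ⌊x / ((i.1:ℕ):ℝ) ^ (i.2+1)⌋₊ = ⌊x⌋₊ / (i.1:ℕ) ^ (i.2+1) := by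
      rw [← Nat.floor_div_natCast]; push_cast; rfl
    rw [this]
    push_cast
    rw [div_pow, ← pow_mul]
    ring
  have hW : ∀ x : ℝ, 3 ≤ x → ∀ i : Nat.Primes × ℕ, 
      ‖a i * ((((⌊x / ((i.1:ℕ):ℝ) ^ (i.2+1)⌋₊ : ℝ) ^ k -
        (x / ((i.1:ℕ):ℝ) ^ (i.2+1)) ^ k : ℝ)) : ℂ)‖ ≤
      (k * x ^ (k-1)) * (‖a i‖ / ((i.1:ℕ):ℝ) ^ ((i.2+1) * (k-1))) := by
    intro x hx i
    rw [norm_mul, Complex.norm_real, Real.norm_eq_abs]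
    have := aux_floor (x / ((i.1:ℕ):ℝ) ^ (i.2+1)) (by positivity) k
    refine (mul_le_mul_of_nonneg_left this (norm_nonneg _)).trans (le_of_eq ?_)
    rw [div_pow, ← pow_mul]
    ring
  refine ⟨?_, ?_, ?_⟩
  · have h1 := (summable_prod_of_nonneg (fun i => norm_nonneg _)).1 hsa'
    refine Summable.of_nonneg_of_le (fun p => norm_nonneg _) (fun p => ?_) h1.2
    exact norm_tsum_le_tsum_norm (h1.1 p)
  · intro hk4
    have hs := hsa (k-1) (by omega)
    set B := ∑' i : Nat.Primes × ℕ, ‖a i‖ / ((i.1:ℕ):ℝ) ^ ((i.2+1) * (k-1)) with hB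
    have hB0 : 0 ≤ B := tsum_nonneg fun i => by positivity
    refine ⟨k * B + 1, by positivity, 3, le_rfl, fun x hx => ?_⟩
    have h1 := (hs.hasSum.mul_left (k * x ^ (k-1)))
    have h2 := tsum_of_norm_bounded h1 (hW x hx)
    rw [(hE x hx).tsum_eq] at h2
    refine h2.trans ?_
    have : 0 ≤ x ^ (k-1) := by positivity
    nlinarith
  · rintro rfl
    have hs := aux_summ2 l C (fun i => ‖a i‖) (fun _ => norm_nonneg _) hab hC
    set B := ∑' i : Nat.Primes × ℕ, if i.2 = 0 then 0 else
      ‖a i‖ / ((i.1:ℕ):ℝ) ^ ((i.2+1) * 2) with hB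
    have hB0 : 0 ≤ B := tsum_nonneg fun i => by split_ifs <;> positivity
    obtain ⟨d, hd, hd'⟩ := aux_loglog
    refine ⟨(26 + 3 * B) / d + 12, by positivity, 3, le_rfl, fun x hx => ?_⟩
    set N := ⌊x⌋₊ with hN
    obtain ⟨T, hT, hT'⟩ := aux_tail N
    have hU : HasSum (fun p : Nat.Primes => if (p:ℕ) ≤ N then 1 / ((p:ℕ):ℝ) else 0)
        (∑ p ∈ (Finset.range (N + 1)).filter Nat.Prime, (1 / (p : ℝ))) := by
      have h1 : ∑ p ∈ (Finset.range (N + 1)).filter Nat.Prime, (1 / (p : ℝ)) =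
          ∑ p ∈ (Finset.range (N + 1)).subtype Nat.Prime, 
            if (p:ℕ) ≤ N then 1 / ((p:ℕ):ℝ) else 0 := by
        rw [Finset.sum_subtype_eq_sum_filter (fun p : ℕ => if p ≤ N then 1 / (p:ℝ) else 0)]
        refine Finset.sum_congr rfl fun p hp => ?_
        simp only [Finset.mem_filter, Finset.mem_range] at hp
        rw [if_pos (by omega)]
      rw [h1]
      refine hasSum_sum_of_ne_finset_zero fun p hp => ?_
      rw [if_neg]
      intro h
      exact hp (Finset.mem_subtype.2 (Finset.mem_range.2 (Nat.lt_succ_of_le h)))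
    have hU' := aux_mertens' x hx
    rw [← hN] at hU'
    set U := ∑ p ∈ (Finset.range (N + 1)).filter Nat.Prime, (1 / (p : ℝ))
    have hG := (hU.mul_left (3 * x^2)).add (hT'.mul_left (x^3))
    set g : Nat.Primes → ℝ := fun p => 3 * x^2 * (if (p:ℕ) ≤ N then 1 / ((p:ℕ):ℝ) else 0) +
      x^3 * (if (p:ℕ) ≤ N then (0:ℝ) else 1 / ((p:ℕ):ℝ)^2) with hg
    have hinj : Function.Injective (fun p : Nat.Primes => ((p, 0) : Nat.Primes × ℕ)) := by
      intro p q h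
      simpa using h
    have hG1 : HasSum (fun i : Nat.Primes × ℕ => if i.2 = 0 then g i.1 else 0)
        (3 * x^2 * U + x^3 * T) := by
      rw [← hinj.hasSum_iff]
      · simpa [Function.comp_def] using hG
      · rintro ⟨p, ν⟩ hi
        rcases ν with _ | ν
        · exact absurd ⟨p, rfl⟩ hi
        · simp
    have hG2 := hG1.add (hs.hasSum.mul_left (3 * x^2))
    have h2 := tsum_of_norm_bounded hG2 (f := fun i : Nat.Primes × ℕ =>
      a i * ((((⌊x / ((i.1:ℕ):ℝ) ^ (i.2+1)⌋₊ : ℝ) ^ 3 -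
        (x / ((i.1:ℕ):ℝ) ^ (i.2+1)) ^ 3 : ℝ)) : ℂ)) ?_
    · rw [(hE x hx).tsum_eq] at h2
      refine h2.trans ?_
      have hL := hd' x hx
      set L := Real.log (Real.log x)
      have hx2 : 0 < x^2 := by positivity
      have hxN : x ≤ (N:ℝ) + 1 := (Nat.lt_floor_add_one x).le
      have hT2 : x^3 * T ≤ 2 * x^2 := by
        have : T ≤ 2 / x := hT.trans (by gcongr)
        calc x^3 * T ≤ x^3 * (2 / x) := by gcongr
          _ = _ := by field_simp
      have h5 : 26 + 3 * B ≤ (26 + 3 * B) / d * L := by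
        rw [div_mul_eq_mul_div, le_div_iff₀ hd]
        gcongr
      calc 3 * x^2 * U + x^3 * T + 3 * x^2 * B 
          ≤ 3 * x^2 * (8 + 4 * L) + 2 * x^2 + 3 * x^2 * B := by gcongr
        _ = x^2 * (26 + 3 * B + 12 * L) := by ring
        _ ≤ x^2 * ((26 + 3 * B) / d * L + 12 * L) := by gcongr
        _ = _ := by ring
    · rintro ⟨p, ν⟩
      rcases ν with _ | ν
      · have hp0 : (0:ℝ) < ((p:ℕ):ℝ) := by exact_mod_cast p.2.pos
        have hna : ‖a (p, 0)‖ = ((p:ℕ):ℝ) := by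
          simp [ha, hf1, hp1 p p.2]
        by_cases hpN : (p:ℕ) ≤ N
        · refine (hW x hx (p, 0)).trans (le_of_eq ?_)
          rw [hna]
          simp [hg, hpN]
          field_simp
          simp
        · have hlt : x < ((p:ℕ):ℝ) := (Nat.floor_lt (by linarith)).1 (not_le.1 hpN)
          have h0 : ⌊x / ((p:ℕ):ℝ)⌋₊ = 0 := by
            rw [Nat.floor_eq_zero, div_lt_one hp0]; exact hlt
          rw [norm_mul, hna, Complex.norm_real, Real.norm_eq_abs]
          simp [hg, hpN, h0]
          rw [abs_of_nonneg (by positivity : (0:ℝ) ≤ x / ((p:ℕ):ℝ))]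
          apply le_of_eq
          field_simp
      · refine (hW x hx (p, ν+1)).trans (le_of_eq ?_)
        simp
end

section
/- Let f : ℕ → ℂ be in the class F₁ and let k ≥ 1 be a fixed integer. Then Σ_{n₁,…,n_k ≤ x} f(lcm(n₁,…,n_k)) = π²·k·x^{k+1} / (12·log x) + O( x^{k+1} / (log x)² ) as x → ∞, where the sum ranges over all k-tuples of positive integers each at most x and lcm(n₁,…,n_k) denotes their least common multiple. -/
namespace LcmSum
open Complex Filter Topology

noncomputable def T (n : ℕ) (s : ℂ) : ℂ :=
  ((n : ℂ) + 2) ^ (-s) - (((n : ℂ) + 2) ^ (1 - s) - ((n : ℂ) + 1) ^ (1 - s)) / (1 - s)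

lemma T_eq (n : ℕ) {s : ℂ} (hs : s ≠ 1) :
    T n s = ∫ u in ((n : ℝ) + 1)..((n : ℝ) + 2), (((n : ℂ) + 2) ^ (-s) - (u : ℂ) ^ (-s)) := by
  have h0 : (0 : ℝ) ∉ Set.uIcc ((n : ℝ) + 1) ((n : ℝ) + 2) := by
    rw [Set.uIcc_of_le (by linarith)]
    intro h
    have := h.1
    have : (0 : ℝ) ≤ n := n.cast_nonneg
    linarith
  have hs' : -s ≠ -1 := by intro h; exact hs (neg_injective h)
  rw [intervalIntegral.integral_sub (by simp) (intervalIntegral.intervalIntegrable_cpow (Or.inr h0)),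
    integral_cpow (Or.inr ⟨hs', h0⟩)]
  simp only [intervalIntegral.integral_const, T]
  have e : -s + 1 = 1 - s := by ring
  rw [e]
  push_cast
  norm_num

lemma diff_bound (s : ℂ) (hs : 0 < s.re) {m u v : ℝ} (hm : 0 < m) (hu : m ≤ u) (huv : u ≤ v) :
    ‖(v : ℂ) ^ (-s) - (u : ℂ) ^ (-s)‖ ≤ ‖s‖ * m ^ (-s.re - 1) * (v - u) := by
  have key := Convex.norm_image_sub_le_of_norm_hasDerivWithin_le
    (f := fun x : ℝ => (x : ℂ) ^ (-s)) (f' := fun x : ℝ => -s * (x : ℂ) ^ (-s - 1))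
    (s := Set.Ici m) (x := u) (y := v) (C := ‖s‖ * m ^ (-s.re - 1)) ?_ ?_ (convex_Ici m) hu
    (le_trans hu huv)
  · simpa [abs_of_nonneg (sub_nonneg.2 huv)] using key
  · intro x hx
    have hx0 : 0 < x := lt_of_lt_of_le hm hx
    have hs0 : -s ≠ 0 := by
      intro h
      have : s = 0 := by simpa using h
      simp [this] at hs
    exact (hasDerivAt_ofReal_cpow_const (x := x) hx0.ne' hs0).hasDerivWithinAt
  · intro x hx
    have hx0 : 0 < x := lt_of_lt_of_le hm hx
    rw [norm_mul, norm_neg, norm_cpow_eq_rpow_re_of_pos hx0]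
    gcongr
    simp only [sub_re, neg_re, one_re]
    exact Real.rpow_le_rpow_of_nonpos hm hx (by linarith)

lemma T_bound1 (n : ℕ) {s : ℂ} (hs : s ≠ 1) (hs0 : 0 < s.re) :
    ‖T n s‖ ≤ ‖s‖ * ((n : ℝ) + 1) ^ (-s.re - 1) := by
  rw [T_eq n hs]
  have := intervalIntegral.norm_integral_le_of_norm_le_const (a := (n : ℝ) + 1) (b := (n : ℝ) + 2)
    (f := fun u : ℝ => (((n : ℂ) + 2) ^ (-s) - (u : ℂ) ^ (-s)))
    (C := ‖s‖ * ((n : ℝ) + 1) ^ (-s.re - 1)) ?_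
  · refine this.trans (le_of_eq ?_)
    norm_num
  · intro u hu
    rw [Set.uIoc_of_le (by linarith)] at hu
    have h := diff_bound s hs0 (m := (n : ℝ) + 1) (u := u) (v := (n : ℝ) + 2) (by positivity)
      hu.1.le hu.2
    push_cast at h
    refine h.trans ?_
    have : ‖s‖ * ((n : ℝ) + 1) ^ (-s.re - 1) ≥ 0 := by positivity
    have h1 := hu.1
    nlinarith

lemma T_bound2 (n : ℕ) {s : ℂ} (hs : s ≠ 1) (hs0 : 0 < s.re) :
    ‖T n s‖ ≤ 2 * ((n : ℝ) + 1) ^ (-s.re) := by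
  rw [T_eq n hs]
  have := intervalIntegral.norm_integral_le_of_norm_le_const (a := (n : ℝ) + 1) (b := (n : ℝ) + 2)
    (f := fun u : ℝ => (((n : ℂ) + 2) ^ (-s) - (u : ℂ) ^ (-s)))
    (C := 2 * ((n : ℝ) + 1) ^ (-s.re)) ?_
  · refine this.trans (le_of_eq ?_)
    norm_num
  · intro u hu
    rw [Set.uIoc_of_le (by linarith)] at hu
    have hm : (0 : ℝ) < (n : ℝ) + 1 := by positivity
    have hu0 : 0 < u := hm.trans hu.1
    refine (norm_sub_le _ _).trans ?_
    have e : ((n : ℂ) + 2) = (((n : ℝ) + 2 : ℝ) : ℂ) := by push_cast; rfl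
    rw [e, norm_cpow_eq_rpow_re_of_pos hu0, norm_cpow_eq_rpow_re_of_pos (by positivity), two_mul]
    gcongr ?_ + ?_
    · exact Real.rpow_le_rpow_of_nonpos hm (by linarith) (by simpa using hs0.le)
    · exact Real.rpow_le_rpow_of_nonpos hm hu.1.le (by simpa using hs0.le)

lemma T_bound (n : ℕ) {s : ℂ} (hs : s ≠ 1) (hs0 : 99 / 100 ≤ s.re) :
    ‖T n s‖ ≤ 2 * ‖s‖ ^ (1 / 50 : ℝ) * ((n : ℝ) + 1) ^ (-(101 / 100) : ℝ) := by
  have hm : (0 : ℝ) < (n : ℝ) + 1 := by positivity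
  have hm1 : (1 : ℝ) ≤ (n : ℝ) + 1 := by simp
  have hs1 : 0 < s.re := by linarith
  have hsn : 0 < ‖s‖ := lt_of_lt_of_le hs1 ((le_abs_self _).trans (abs_re_le_norm s))
  have key : ‖T n s‖ ≤ 2 * ((n : ℝ) + 1) ^ (-s.re) * (‖s‖ / ((n : ℝ) + 1)) ^ (1 / 50 : ℝ) := by
    have hA : 0 < ((n : ℝ) + 1) ^ (-s.re) := by positivity
    by_cases h : 1 ≤ ‖s‖ / ((n : ℝ) + 1)
    · refine (T_bound2 n hs hs1).trans ?_
      have : 1 ≤ (‖s‖ / ((n : ℝ) + 1)) ^ (1 / 50 : ℝ) := Real.one_le_rpow h (by norm_num)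
      nlinarith
    · push Not at h
      have h0 : 0 < ‖s‖ / ((n : ℝ) + 1) := by positivity
      have : (‖s‖ / ((n : ℝ) + 1)) ^ (1 : ℝ) ≤ (‖s‖ / ((n : ℝ) + 1)) ^ (1 / 50 : ℝ) :=
        Real.rpow_le_rpow_of_exponent_ge h0 h.le (by norm_num)
      rw [Real.rpow_one] at this
      refine (T_bound1 n hs hs1).trans ?_
      rw [Real.rpow_sub hm, Real.rpow_one]
      have e : ‖s‖ * (((n : ℝ) + 1) ^ (-s.re) / ((n : ℝ) + 1)) =
        ((n : ℝ) + 1) ^ (-s.re) * (‖s‖ / ((n : ℝ) + 1)) := by ring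
      rw [e]
      have h3 := mul_le_mul_of_nonneg_left this hA.le
      have h4 : 0 ≤ ((n : ℝ) + 1) ^ (-s.re) * (‖s‖ / ((n : ℝ) + 1)) ^ (1 / 50 : ℝ) := by positivity
      linarith
  refine key.trans ?_
  rw [Real.div_rpow hsn.le hm.le]
  have e : 2 * ((n : ℝ) + 1) ^ (-s.re) * (‖s‖ ^ (1 / 50 : ℝ) / ((n : ℝ) + 1) ^ (1 / 50 : ℝ)) =
    2 * ‖s‖ ^ (1 / 50 : ℝ) * ((n : ℝ) + 1) ^ (-s.re - 1 / 50) := by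
    rw [Real.rpow_sub hm]; ring
  rw [e]
  gcongr
  linarith

lemma summable_T_maj : Summable (fun n : ℕ => ((n : ℝ) + 1) ^ (-(101 / 100) : ℝ)) := by
  have := (summable_nat_add_iff 1).2 (Real.summable_nat_rpow.2 (show (-(101/100) : ℝ) < -1 by norm_num))
  simpa using this

lemma summable_T {s : ℂ} (hs : s ≠ 1) (hs0 : 99 / 100 ≤ s.re) : Summable (fun n => T n s) :=
  Summable.of_norm_bounded (summable_T_maj.mul_left (2 * ‖s‖ ^ (1 / 50 : ℝ))) 
    (fun n => T_bound n hs hs0)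

lemma zeta_eq_of_one_lt {s : ℂ} (hs : 1 < s.re) :
    riemannZeta s = 1 + 1 / (s - 1) + ∑' n, T n s := by
  have hs1 : s ≠ 1 := by intro h; simp [h] at hs
  have hsub : 1 - s ≠ 0 := sub_ne_zero.2 hs1.symm
  have hsub' : s - 1 ≠ 0 := sub_ne_zero.2 hs1
  have h1 := (summable_T hs1 (by linarith)).hasSum.tendsto_sum_nat
  have hz : Summable (fun n : ℕ => 1 / ((n : ℂ) + 1) ^ s) := by
    have := (summable_nat_add_iff 1).2 (Complex.summable_one_div_nat_cpow.2 hs)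
    simpa using this
  have h2 : Tendsto (fun N : ℕ => ∑ n ∈ Finset.range (N + 1), 1 / ((n : ℂ) + 1) ^ s) atTop
      (𝓝 (riemannZeta s)) := by
    rw [zeta_eq_tsum_one_div_nat_add_one_cpow hs]
    exact (tendsto_add_atTop_iff_nat 1).2 hz.hasSum.tendsto_sum_nat
  have h3 : Tendsto (fun N : ℕ => ((N : ℂ) + 1) ^ (1 - s)) atTop (𝓝 0) := by
    rw [tendsto_zero_iff_norm_tendsto_zero]
    have : ∀ N : ℕ, ‖((N : ℂ) + 1) ^ (1 - s)‖ = (((N : ℝ) + 1)) ^ (-(s.re - 1)) := by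
      intro N
      have e : ((N : ℂ) + 1) = (((N : ℝ) + 1 : ℝ) : ℂ) := by push_cast; rfl
      rw [e, norm_cpow_eq_rpow_re_of_pos (by positivity)]
      simp
    simp_rw [this]
    exact (tendsto_rpow_neg_atTop (by linarith)).comp
      (tendsto_atTop_add_const_right _ _ tendsto_natCast_atTop_atTop)
  have h4 : ∀ N : ℕ, ∑ n ∈ Finset.range N, T n s =
      (∑ n ∈ Finset.range (N + 1), 1 / ((n : ℂ) + 1) ^ s) - 1 -
        (((N : ℂ) + 1) ^ (1 - s) - 1) / (1 - s) := by
    intro N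
    induction N with
    | zero => simp
    | succ N ih =>
      rw [Finset.sum_range_succ, ih, Finset.sum_range_succ _ (N + 1), T]
      push_cast
      rw [cpow_neg, show (N : ℂ) + 1 + 1 = N + 2 by ring]
      field_simp
      ring
  simp_rw [h4] at h1
  have h5 := (h2.sub_const 1).sub ((h3.sub_const 1).div_const (1 - s))
  have h6 := tendsto_nhds_unique h1 h5
  rw [h6]
  have : s - 1 = -(1 - s) := by ring
  rw [this]
  field_simp
  ring

lemma zeta_eq_T (U : Set ℂ) (hU : IsOpen U) (hc : Convex ℝ U) (h1 : (1 : ℂ) ∉ U)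
    (hre : ∀ s ∈ U, 98 / 100 < s.re) (z : ℂ) (hz : z ∈ U) (hzr : 1 < z.re) :
    ∀ s ∈ U, 99 / 100 < s.re → riemannZeta s = 1 + 1 / (s - 1) + ∑' n, T n s := by
  set V := U ∩ {s : ℂ | 99 / 100 < s.re} with hV
  have hVo : IsOpen V := hU.inter (isOpen_lt continuous_const continuous_re)
  have hVc : Convex ℝ V := hc.inter (convex_halfSpace_re_gt _)
  have hne : ∀ s ∈ V, s ≠ 1 := fun s hs h => h1 (h ▸ hs.1)
  have hd1 : DifferentiableOn ℂ riemannZeta V := fun s hs =>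
    (differentiableAt_riemannZeta (hne s hs)).differentiableWithinAt
  have hd2 : DifferentiableOn ℂ (fun s => ∑' n, T n s) V := by
    intro s hs
    set W := V ∩ Metric.ball (0 : ℂ) (‖s‖ + 1) with hW
    have hWo : IsOpen W := hVo.inter Metric.isOpen_ball
    have hsW : s ∈ W := ⟨hs, by simp⟩
    have : DifferentiableOn ℂ (fun s => ∑' n, T n s) W := by
      refine differentiableOn_tsum_of_summable_norm
        (u := fun n : ℕ => 2 * (‖s‖ + 1) ^ (1 / 50 : ℝ) * ((n : ℝ) + 1) ^ (-(101 / 100) : ℝ))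
        (summable_T_maj.mul_left _) ?_ hWo ?_
      · intro n w hw
        have hw1 : 1 - w ≠ 0 := sub_ne_zero.2 (hne w hw.1).symm
        have a1 : ((n : ℂ) + 1) ≠ 0 := by exact_mod_cast Nat.succ_ne_zero n
        have a2 : ((n : ℂ) + 2) ≠ 0 := by exact_mod_cast Nat.succ_ne_zero (n + 1)
        unfold T
        apply DifferentiableAt.differentiableWithinAt
        refine DifferentiableAt.sub ?_ (DifferentiableAt.div (DifferentiableAt.sub ?_ ?_) (by fun_prop) hw1)
        · exact (differentiableAt_id.neg).const_cpow (Or.inl a2)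
        · exact (differentiableAt_id.const_sub 1).const_cpow (Or.inl a2)
        · exact (differentiableAt_id.const_sub 1).const_cpow (Or.inl a1)
      · intro n w hw
        refine (T_bound n (hne w hw.1) hw.1.2.le).trans ?_
        have := hw.2
        simp only [Metric.mem_ball, dist_zero_right] at this
        gcongr
    exact ((this s hsW).differentiableAt (hWo.mem_nhds hsW)).differentiableWithinAt
  have hd3 : DifferentiableOn ℂ (fun s => 1 + 1 / (s - 1) + ∑' n, T n s) V := by
    refine DifferentiableOn.add (fun s hs => ?_) hd2
    have hw1 : s - 1 ≠ 0 := sub_ne_zero.2 (hne s hs)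
    exact DifferentiableAt.differentiableWithinAt (by fun_prop (disch := assumption))
  have hzV : z ∈ V := ⟨hz, by simp only [Set.mem_ofPred_eq]; linarith⟩
  have := (hd1.analyticOnNhd hVo).eqOn_of_preconnected_of_eventuallyEq (hd3.analyticOnNhd hVo)
    hVc.isPreconnected hzV (by
      filter_upwards [(isOpen_lt continuous_const continuous_re).mem_nhds
        (show z ∈ {s : ℂ | 1 < s.re} from hzr)] with s hs
      exact zeta_eq_of_one_lt hs)
  intro s hs hs2
  exact this ⟨hs, hs2⟩

lemma zeta_eq_T' {s : ℂ} (hs : 99 / 100 < s.re) (hi : s.im ≠ 0) :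
    riemannZeta s = 1 + 1 / (s - 1) + ∑' n, T n s := by
  rcases lt_or_gt_of_ne hi with h | h
  · refine zeta_eq_T ({s : ℂ | s.im < 0} ∩ {s : ℂ | 98 / 100 < s.re})
      ((isOpen_lt continuous_im continuous_const).inter (isOpen_lt continuous_const continuous_re))
      ((convex_halfSpace_im_lt _).inter (convex_halfSpace_re_gt _)) (by simp) (fun s h => h.2)
      (2 - I) (by norm_num) (by norm_num) s ⟨h, by simp only [Set.mem_ofPred_eq]; linarith⟩ hs
  · refine zeta_eq_T ({s : ℂ | 0 < s.im} ∩ {s : ℂ | 98 / 100 < s.re})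
      ((isOpen_lt continuous_const continuous_im).inter (isOpen_lt continuous_const continuous_re))
      ((convex_halfSpace_im_gt _).inter (convex_halfSpace_re_gt _)) (by simp) (fun s h => h.2)
      (2 + I) (by norm_num) (by norm_num) s ⟨h, by simp only [Set.mem_ofPred_eq]; linarith⟩ hs

/-- Growth of zeta slightly to the left of the line `re s = 1`. -/
lemma zeta_growth : ∃ C : ℝ, 1 ≤ C ∧ ∀ s : ℂ, 99 / 100 < s.re → s.re ≤ 4 → 1 / 2 ≤ |s.im| →
    ‖riemannZeta s‖ ≤ C * |s.im| ^ (1 / 50 : ℝ) := by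
  set S := ∑' n : ℕ, ((n : ℝ) + 1) ^ (-(101 / 100) : ℝ) with hS
  have hS0 : 0 ≤ S := tsum_nonneg (fun n => by positivity)
  refine ⟨(3 + 2 * S) * 9, by linarith, fun s hs hs4 hi => ?_⟩
  have hi0 : s.im ≠ 0 := by intro h; rw [h] at hi; norm_num at hi
  have hs1 : s ≠ 1 := by rintro rfl; simp at hi0
  rw [zeta_eq_T' hs hi0]
  have hns : 9 / 10 ≤ ‖s‖ := by
    have := (le_abs_self _).trans (abs_re_le_norm s)
    linarith
  have hns' : ‖s‖ ≤ 9 * |s.im| := by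
    have := norm_le_abs_re_add_abs_im s
    rw [abs_of_pos (by linarith : 0 < s.re)] at this
    linarith
  have hsub : 1 / 2 ≤ ‖s - 1‖ := by
    have := abs_im_le_norm (s - 1)
    simp at this
    norm_num at *
    linarith
  have hb : ‖∑' n, T n s‖ ≤ 2 * ‖s‖ ^ (1 / 50 : ℝ) * S := by
    rw [hS, ← tsum_mul_left]
    exact tsum_of_norm_bounded (summable_T_maj.mul_left _).hasSum (fun n => T_bound n hs1 hs.le)
  have h9 : 9 ^ (1 / 50 : ℝ) ≤ (9 : ℝ) := by
    calc (9 : ℝ) ^ (1 / 50 : ℝ) ≤ 9 ^ (1 : ℝ) := Real.rpow_le_rpow_of_exponent_le (by norm_num) (by norm_num)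
      _ = 9 := by norm_num
  have hp : ‖s‖ ^ (1 / 50 : ℝ) ≤ 9 * |s.im| ^ (1 / 50 : ℝ) := by
    calc ‖s‖ ^ (1 / 50 : ℝ) ≤ (9 * |s.im|) ^ (1 / 50 : ℝ) := by gcongr
      _ = 9 ^ (1 / 50 : ℝ) * |s.im| ^ (1 / 50 : ℝ) := by rw [Real.mul_rpow (by norm_num) (by positivity)]
      _ ≤ _ := by gcongr
  have hone : 1 ≤ 9 * |s.im| ^ (1 / 50 : ℝ) := by
    have : (1 : ℝ) ≤ (9 * |s.im|) ^ (1 / 50 : ℝ) := Real.one_le_rpow (by linarith) (by norm_num)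
    rw [Real.mul_rpow (by norm_num) (by positivity)] at this
    have h0 : 0 ≤ |s.im| ^ (1 / 50 : ℝ) := by positivity
    nlinarith
  have h2 : ‖1 / (s - 1)‖ ≤ 2 := by
    rw [norm_div, norm_one, div_le_iff₀ (by linarith)]
    linarith
  calc ‖1 + 1 / (s - 1) + ∑' n, T n s‖ ≤ 1 + 2 + 2 * ‖s‖ ^ (1 / 50 : ℝ) * S := by
        refine (norm_add_le _ _).trans (add_le_add ((norm_add_le _ _).trans ?_) hb)
        simp only [norm_one]
        linarith
    _ ≤ (3 + 2 * S) * 9 * |s.im| ^ (1 / 50 : ℝ) := by nlinarith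

end LcmSum


namespace LcmSum
open Complex Filter Topology

lemma zeta_deriv_growth : ∃ C : ℝ, 1 ≤ C ∧ ∀ j : ℕ, j ≤ 3 → ∀ s : ℂ, 1 ≤ s.re → s.re ≤ 3 →
    1 ≤ |s.im| → ‖iteratedDeriv j riemannZeta s‖ ≤ C * |s.im| ^ (1 / 50 : ℝ) := by
  obtain ⟨C, hC1, hC⟩ := zeta_growth
  refine ⟨6 * (C * 2) * 200 ^ 3, by nlinarith, fun j hj s hs1 hs3 hi => ?_⟩
  have hw : ∀ w : ℂ, ‖w - s‖ ≤ 1 / 200 → |w.re - s.re| ≤ 1 / 200 ∧ |w.im - s.im| ≤ 1 / 200 := by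
    intro w hw
    have h1 := abs_re_le_norm (w - s)
    have h2 := abs_im_le_norm (w - s)
    simp only [sub_re, sub_im] at h1 h2
    exact ⟨h1.trans hw, h2.trans hw⟩
  have hbd : ∀ w ∈ Metric.sphere s (1 / 200), ‖riemannZeta w‖ ≤ C * 2 * |s.im| ^ (1 / 50 : ℝ) := by
    intro w hws
    obtain ⟨h1, h2⟩ := hw w (by rw [mem_sphere_iff_norm] at hws; exact hws.le)
    have h3 := abs_le.1 h1
    have h4 : |s.im| ≤ |w.im| + 1 / 200 := by
      have := abs_sub_abs_le_abs_sub s.im w.im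
      rw [abs_sub_comm] at this
      linarith
    have h5 : |w.im| ≤ 2 * |s.im| := by
      have := abs_sub_abs_le_abs_sub w.im s.im
      linarith
    have h6 : (2 : ℝ) ^ (1 / 50 : ℝ) ≤ 2 := by
      calc (2 : ℝ) ^ (1 / 50 : ℝ) ≤ 2 ^ (1 : ℝ) :=
            Real.rpow_le_rpow_of_exponent_le (by norm_num) (by norm_num)
        _ = 2 := by norm_num
    calc ‖riemannZeta w‖ ≤ C * |w.im| ^ (1 / 50 : ℝ) :=
          hC w (by linarith) (by linarith) (by linarith)
      _ ≤ C * (2 * |s.im|) ^ (1 / 50 : ℝ) := by gcongr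
      _ = C * (2 ^ (1 / 50 : ℝ) * |s.im| ^ (1 / 50 : ℝ)) := by
          rw [Real.mul_rpow (by norm_num) (by positivity)]
      _ ≤ C * (2 * |s.im| ^ (1 / 50 : ℝ)) := by gcongr
      _ = _ := by ring
  have hdc : DiffContOnCl ℂ riemannZeta (Metric.ball s (1 / 200)) := by
    apply DifferentiableOn.diffContOnCl
    intro w hwb
    rw [closure_ball _ (by norm_num), Metric.mem_closedBall, dist_eq_norm] at hwb
    obtain ⟨h1, h2⟩ := hw w hwb
    refine (differentiableAt_riemannZeta ?_).differentiableWithinAt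
    rintro rfl
    simp only [one_im, zero_sub, abs_neg] at h2
    linarith
  have key := norm_iteratedDeriv_le_of_forall_mem_sphere_norm_le j (by norm_num) hdc hbd
  refine key.trans ?_
  have hf : (j.factorial : ℝ) ≤ 6 := by
    have := Nat.factorial_le hj
    exact_mod_cast this
  have hp : (200 : ℝ) ^ j ≤ 200 ^ 3 := pow_le_pow_right₀ (by norm_num) hj
  have e : (j.factorial : ℝ) * (C * 2 * |s.im| ^ (1 / 50 : ℝ)) / (1 / 200) ^ j =
      j.factorial * (C * 2) * 200 ^ j * |s.im| ^ (1 / 50 : ℝ) := by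
    rw [div_pow, one_pow]; field_simp
  rw [e]
  gcongr

lemma zeta_real_bound : ∃ C : ℝ, 1 ≤ C ∧ ∀ x : ℝ, 0 < x → x ≤ 2 →
    ‖riemannZeta (1 + x)‖ ≤ C / x := by
  obtain ⟨C, hC⟩ := (isCompact_Icc (a := (0 : ℝ)) (b := 2)).exists_bound_of_continuousOn
    (f := fun x : ℝ => riemannZeta₁ (1 + x))
    ((differentiable_riemannZeta₁.continuous.comp (by fun_prop)).continuousOn)
  refine ⟨max C 1, le_max_right _ _, fun x hx hx2 => ?_⟩
  have h1 : (1 + x : ℂ) ≠ 1 := by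
    intro h
    have : (x : ℂ) = 0 := by simpa using h
    exact hx.ne' (by exact_mod_cast this)
  rw [riemannZeta_eq_inv_sub_mul h1]
  have h2 := hC x ⟨hx.le, hx2⟩
  simp only [add_sub_cancel_left, norm_mul, norm_inv, norm_real, Real.norm_eq_abs, abs_of_pos hx]
  rw [div_eq_inv_mul]
  gcongr
  exact h2.trans (le_max_left _ _)

lemma zeta_341 (x : ℝ) (hx : 0 < x) (y : ℝ) :
    1 ≤ ‖riemannZeta (1 + x)‖ ^ 3 * ‖riemannZeta (1 + x + I * y)‖ ^ 4 *
      ‖riemannZeta (1 + x + 2 * I * y)‖ := by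
  have := DirichletCharacter.norm_LFunction_product_ge_one (1 : DirichletCharacter ℂ 1) hx y
  simpa [DirichletCharacter.LFunctionTrivChar, DirichletCharacter.LFunction_modOne_eq] using this

lemma zeta_lower : ∃ c : ℝ, 0 < c ∧ ∀ s : ℂ, 1 ≤ s.re → s.re ≤ 2 → 1 ≤ |s.im| →
    c ≤ ‖riemannZeta s‖ * (|s.im| ^ (1 / 50 : ℝ)) ^ 4 := by
  obtain ⟨C, hC1, hC⟩ := zeta_deriv_growth
  obtain ⟨D, hD1, hD⟩ := zeta_real_bound
  obtain ⟨E, hE1, hE⟩ := zeta_growth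
  set κ : ℝ := 1 / (32 * D ^ 3 * E * C ^ 4) with hκ
  have hκ0 : 0 < κ := by positivity
  have hκ1 : κ ≤ 1 := by
    rw [hκ, div_le_one (by positivity)]
    have : 1 ≤ D ^ 3 * E * C ^ 4 := by
      have a := one_le_pow₀ hD1 (n := 3)
      have b := one_le_pow₀ hC1 (n := 4)
      exact one_le_mul_of_one_le_of_one_le (one_le_mul_of_one_le_of_one_le a hE1) b
    nlinarith
  refine ⟨C * κ, by positivity, fun s hs1 hs2 hi => ?_⟩
  set Q := |s.im| ^ (1 / 50 : ℝ) with hQ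
  have hQ1 : 1 ≤ Q := Real.one_le_rpow hi (by norm_num)
  have hQ0 : 0 < Q := by linarith
  set η := κ / Q ^ 5 with hη
  have hη0 : 0 < η := by positivity
  have hη1 : η ≤ 1 := by
    rw [hη, div_le_one (by positivity)]
    exact hκ1.trans (one_le_pow₀ hQ1)
  set x : ℝ := s.re - 1 + η with hx
  have hx0 : 0 < x := by linarith
  have hx2 : x ≤ 2 := by linarith
  have hs'e : (1 + x + I * s.im : ℂ) = s + η := by
    apply Complex.ext
    · simp [hx]; ring
    · simp
  have h341 := zeta_341 x hx0 s.im
  rw [hs'e] at h341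
  have hb1 := hD x hx0 hx2
  have hb1' : ‖riemannZeta (1 + x)‖ ≤ D / η := hb1.trans (by gcongr; linarith)
  have hb2 : ‖riemannZeta (1 + x + 2 * I * s.im)‖ ≤ E * (2 * Q) := by
    have := hE (1 + x + 2 * I * s.im) (by simp; linarith) (by simp; linarith)
      (by simp [abs_mul]; linarith)
    refine this.trans ?_
    gcongr
    have e : |(1 + x + 2 * I * s.im : ℂ).im| = 2 * |s.im| := by simp [abs_mul]
    rw [e, Real.mul_rpow (by norm_num) (by positivity)]
    gcongr
    calc (2 : ℝ) ^ (1 / 50 : ℝ) ≤ 2 ^ (1 : ℝ) :=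
            Real.rpow_le_rpow_of_exponent_le (by norm_num) (by norm_num)
        _ = 2 := by norm_num
  set Y := ‖riemannZeta (s + η)‖ with hY
  have h4 : (2 * C * η * Q) ^ 4 ≤ Y ^ 4 := by
    have h5 : 1 ≤ (D / η) ^ 3 * Y ^ 4 * (E * (2 * Q)) := h341.trans (by gcongr)
    have h6 : η ^ 3 ≤ D ^ 3 * Y ^ 4 * (E * (2 * Q)) := by
      calc η ^ 3 = η ^ 3 * 1 := by ring
        _ ≤ η ^ 3 * ((D / η) ^ 3 * Y ^ 4 * (E * (2 * Q))) := by gcongr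
        _ = _ := by field_simp
    have h7 : (2 * C * η * Q) ^ 4 * (D ^ 3 * (E * (2 * Q))) = η ^ 3 := by
      have : η * Q ^ 5 * (32 * D ^ 3 * E * C ^ 4) = 1 := by
        rw [hη, hκ]; field_simp
      calc (2 * C * η * Q) ^ 4 * (D ^ 3 * (E * (2 * Q)))
          = η ^ 3 * (η * Q ^ 5 * (32 * D ^ 3 * E * C ^ 4)) := by ring
        _ = η ^ 3 := by rw [this, mul_one]
    rw [← h7] at h6
    have hpos : 0 < D ^ 3 * (E * (2 * Q)) := by positivity
    refine le_of_mul_le_mul_right ?_ hpos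
    linarith
  have h8 : 2 * C * η * Q ≤ Y := le_of_pow_le_pow_left₀ (by norm_num) (norm_nonneg _) h4
  have h9 : ‖riemannZeta (s + η) - riemannZeta s‖ ≤ C * Q * η := by
    have hseg : ∀ w ∈ segment ℝ s (s + η), 1 ≤ w.re ∧ w.re ≤ 3 ∧ w.im = s.im := by
      intro w hw
      rw [segment_eq_image'] at hw
      obtain ⟨θ, hθ, rfl⟩ := hw
      have h01 : 0 ≤ θ * η := mul_nonneg hθ.1 hη0.le
      have h02 : θ * η ≤ 1 := mul_le_one₀ hθ.2 hη0.le hη1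
      refine ⟨?_, ?_, ?_⟩
      · simp; linarith
      · simp; linarith
      · simp
    have := Convex.norm_image_sub_le_of_norm_hasDerivWithin_le (𝕜 := ℂ)
      (f := riemannZeta) (f' := deriv riemannZeta) (s := segment ℝ s (s + η)) (x := s)
      (y := s + η) (C := C * Q) ?_ ?_ (convex_segment _ _) (left_mem_segment _ _ _)
      (right_mem_segment _ _ _)
    · simpa [abs_of_pos hη0] using this
    · intro w hw
      obtain ⟨h1, h2, h3⟩ := hseg w hw
      refine (differentiableAt_riemannZeta ?_).hasDerivAt.hasDerivWithinAt
      rintro rfl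
      simp at h3
      rw [← h3] at hi
      norm_num at hi
    · intro w hw
      obtain ⟨h1, h2, h3⟩ := hseg w hw
      have := hC 1 (by norm_num) w h1 h2 (by rw [h3]; exact hi)
      rwa [iteratedDeriv_one, h3] at this
  have h10 : Y ≤ ‖riemannZeta s‖ + C * Q * η := by
    have := norm_sub_norm_le (riemannZeta (s + η)) (riemannZeta s)
    linarith
  have h11 : C * Q * η ≤ ‖riemannZeta s‖ := by linarith
  have h12 : C * κ = C * Q * η * Q ^ 4 := by rw [hη]; field_simp
  rw [h12]
  gcongr

/-- `-ζ'/ζ - ζ`, with the singularity at `1` removed. -/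
noncomputable def F (s : ℂ) : ℂ := -deriv riemannZeta₁ s / riemannZeta₁ s - riemannZeta₀ s

lemma zeta1_ne_zero {s : ℂ} (hs : 1 ≤ s.re) : riemannZeta₁ s ≠ 0 := by
  by_cases h : s = 1
  · simp [h]
  · have h1 := riemannZeta_ne_zero_of_one_le_re hs
    rw [riemannZeta_eq_inv_sub_mul h] at h1
    exact right_ne_zero_of_mul h1

lemma F_eq {s : ℂ} (hs : 1 ≤ s.re) (h1 : s ≠ 1) :
    F s = -deriv riemannZeta s / riemannZeta s - riemannZeta s := by
  have h0 := zeta1_ne_zero hs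
  have hsub : s - 1 ≠ 0 := sub_ne_zero.2 h1
  rw [F, deriv_riemannZeta_eq_neg_inv_sub_sq_mul_add h1]
  have e1 : riemannZeta₀ s = riemannZeta s - (s - 1)⁻¹ := by
    rw [riemannZeta_eq_inv_sub_add h1]; ring
  rw [e1, riemannZeta_eq_inv_sub_mul h1]
  field_simp
  ring

lemma analyticAt_F {s : ℂ} (hs : 1 ≤ s.re) : AnalyticAt ℂ F s := by
  have a1 : AnalyticAt ℂ riemannZeta₁ s := differentiable_riemannZeta₁.analyticAt s
  have a0 : AnalyticAt ℂ riemannZeta₀ s := differentiable_riemannZeta₀.analyticAt s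
  exact ((a1.deriv.neg).div a1 (zeta1_ne_zero hs)).sub a0

lemma F_compact : ∃ C : ℝ, 0 ≤ C ∧ ∀ s : ℂ, 1 ≤ s.re → s.re ≤ 2 → |s.im| ≤ 1 →
    ‖deriv (deriv F) s‖ ≤ C := by
  obtain ⟨C, hC⟩ := (isCompact_Icc.reProdIm isCompact_Icc :
    IsCompact ((Set.Icc (1 : ℝ) 2) ×ℂ (Set.Icc (-1 : ℝ) 1))).exists_bound_of_continuousOn
    (f := fun s => deriv (deriv F) s) (fun s hs =>
      ((analyticAt_F hs.1.1).deriv.deriv).continuousAt.continuousWithinAt)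
  refine ⟨max C 0, le_max_right _ _, fun s h1 h2 h3 => (hC s ?_).trans (le_max_left _ _)⟩
  exact ⟨⟨h1, h2⟩, abs_le.1 h3⟩

lemma F_deriv2 {s : ℂ} (hs : 1 < s.re) :
    deriv (deriv F) s = -iteratedDeriv 3 riemannZeta s / riemannZeta s
      + 3 * iteratedDeriv 2 riemannZeta s * iteratedDeriv 1 riemannZeta s / riemannZeta s ^ 2
      - 2 * iteratedDeriv 1 riemannZeta s ^ 3 / riemannZeta s ^ 3
      - iteratedDeriv 2 riemannZeta s := by
  have hne : ∀ w : ℂ, 1 < w.re → w ≠ 1 := by rintro w hw rfl; simp at hw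
  have hopen : ∀ w : ℂ, 1 < w.re → ∀ᶠ z in 𝓝 w, 1 < z.re := fun w hw =>
    (isOpen_lt continuous_const continuous_re).mem_nhds hw
  have han : ∀ w : ℂ, 1 < w.re → AnalyticAt ℂ riemannZeta w := by
    intro w hw
    rw [Complex.analyticAt_iff_eventually_differentiableAt]
    filter_upwards [hopen w hw] with z hz
    exact differentiableAt_riemannZeta (hne z hz)
  set z0 := riemannZeta
  set z1 := deriv riemannZeta with hz1
  set z2 := deriv z1 with hz2
  set z3 := deriv z2 with hz3
  have hd0 : ∀ w : ℂ, 1 < w.re → HasDerivAt z0 (z1 w) w := fun w hw =>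
    (han w hw).differentiableAt.hasDerivAt
  have hd1 : ∀ w : ℂ, 1 < w.re → HasDerivAt z1 (z2 w) w := fun w hw =>
    (han w hw).deriv.differentiableAt.hasDerivAt
  have hd2 : ∀ w : ℂ, 1 < w.re → HasDerivAt z2 (z3 w) w := fun w hw =>
    (han w hw).deriv.deriv.differentiableAt.hasDerivAt
  have hn : ∀ w : ℂ, 1 < w.re → z0 w ≠ 0 := fun w hw => riemannZeta_ne_zero_of_one_le_re hw.le
  have e1 : ∀ w : ℂ, 1 < w.re → deriv F w = -z2 w / z0 w + z1 w ^ 2 / z0 w ^ 2 - z1 w := by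
    intro w hw
    have : F =ᶠ[𝓝 w] fun z => -z1 z / z0 z - z0 z := by
      filter_upwards [hopen w hw] with z hz
      exact F_eq hz.le (hne z hz)
    rw [this.deriv_eq]
    have h := (((hd1 w hw).neg).div (hd0 w hw) (hn w hw)).sub (hd0 w hw)
    have := hn w hw
    refine h.deriv.trans ?_
    simp only [Pi.neg_apply]
    field_simp
    ring
  have e2 : deriv F =ᶠ[𝓝 s] fun w => -z2 w / z0 w + z1 w ^ 2 / z0 w ^ 2 - z1 w := by
    filter_upwards [hopen s hs] with z hz
    exact e1 z hz
  rw [e2.deriv_eq]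
  have h := ((((hd2 s hs).neg).div (hd0 s hs) (hn s hs)).add
    (((hd1 s hs).pow 2).div ((hd0 s hs).pow 2) (pow_ne_zero 2 (hn s hs)))).sub (hd1 s hs)
  have := hn s hs
  refine h.deriv.trans ?_
  have i1 : iteratedDeriv 1 z0 = z1 := iteratedDeriv_one
  have i2 : iteratedDeriv 2 z0 = z2 := by rw [iteratedDeriv_succ, i1]
  have i3 : iteratedDeriv 3 z0 = z3 := by rw [iteratedDeriv_succ, i2]
  rw [i1, i2, i3]
  simp only [Pi.neg_apply, Pi.pow_apply]
  field_simp
  push_cast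
  ring

lemma F_bound : ∃ C : ℝ, 0 < C ∧ ∀ s : ℂ, 1 < s.re → s.re ≤ 2 →
    ‖deriv (deriv F) s‖ ≤ C * (1 + |s.im|) ^ (1 / 2 : ℝ) := by
  obtain ⟨A, hA0, hA⟩ := F_compact
  obtain ⟨C, hC1, hC⟩ := zeta_deriv_growth
  obtain ⟨c, hc0, hc⟩ := zeta_lower
  set L := C / c + 3 * C ^ 2 / c ^ 2 + 2 * C ^ 3 / c ^ 3 + C with hL
  have hL0 : 0 < L := by positivity
  refine ⟨A + L, by positivity, fun s hs1 hs2 => ?_⟩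
  have hb1 : 1 ≤ (1 + |s.im|) ^ (1 / 2 : ℝ) :=
    Real.one_le_rpow (by linarith [abs_nonneg s.im]) (by norm_num)
  by_cases hi : |s.im| ≤ 1
  · have := hA s hs1.le hs2 hi
    nlinarith
  · push Not at hi
    set Q := |s.im| ^ (1 / 50 : ℝ) with hQ
    have hQ1 : 1 ≤ Q := Real.one_le_rpow hi.le (by norm_num)
    have hQ0 : 0 < Q := by linarith
    have hinv : ‖(riemannZeta s)⁻¹‖ ≤ Q ^ 4 / c := by
      have := hc s hs1.le hs2 hi.le
      have hz : 0 < ‖riemannZeta s‖ := norm_pos_iff.2 (riemannZeta_ne_zero_of_one_le_re hs1.le)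
      rw [norm_inv, inv_le_comm₀ hz (by positivity), inv_div, div_le_iff₀ (by positivity)]
      exact this
    have h1 := hC 1 (by norm_num) s hs1.le (by linarith) hi.le
    have h2 := hC 2 (by norm_num) s hs1.le (by linarith) hi.le
    have h3 := hC 3 (by norm_num) s hs1.le (by linarith) hi.le
    rw [← hQ] at h1 h2 h3
    have hfin : ‖deriv (deriv F) s‖ ≤ L * Q ^ 15 := by
      rw [F_deriv2 hs1]
      set w1 := iteratedDeriv 1 riemannZeta s
      set w2 := iteratedDeriv 2 riemannZeta s
      set w3 := iteratedDeriv 3 riemannZeta s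
      set v := (riemannZeta s)⁻¹
      have e : -w3 / riemannZeta s + 3 * w2 * w1 / riemannZeta s ^ 2 -
          2 * w1 ^ 3 / riemannZeta s ^ 3 - w2 =
          -w3 * v + 3 * w2 * w1 * v ^ 2 - 2 * w1 ^ 3 * v ^ 3 - w2 := by
        simp only [v, div_eq_mul_inv, inv_pow]
      rw [e]
      have hp : ∀ n : ℕ, n ≤ 15 → Q ^ n ≤ Q ^ 15 := fun n hn => pow_le_pow_right₀ hQ1 hn
      have b1 : ‖-w3 * v‖ ≤ C / c * Q ^ 15 := by
        rw [norm_mul, norm_neg]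
        calc ‖w3‖ * ‖v‖ ≤ (C * Q) * (Q ^ 4 / c) := by gcongr
          _ = C / c * Q ^ 5 := by ring
          _ ≤ _ := by gcongr; norm_num
      have b2 : ‖3 * w2 * w1 * v ^ 2‖ ≤ 3 * C ^ 2 / c ^ 2 * Q ^ 15 := by
        rw [norm_mul, norm_mul, norm_mul, norm_pow, Complex.norm_ofNat]
        calc 3 * ‖w2‖ * ‖w1‖ * ‖v‖ ^ 2 ≤ 3 * (C * Q) * (C * Q) * (Q ^ 4 / c) ^ 2 := by gcongr
          _ = 3 * C ^ 2 / c ^ 2 * Q ^ 10 := by ring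
          _ ≤ _ := by gcongr; norm_num
      have b3 : ‖2 * w1 ^ 3 * v ^ 3‖ ≤ 2 * C ^ 3 / c ^ 3 * Q ^ 15 := by
        rw [norm_mul, norm_mul, norm_pow, norm_pow, Complex.norm_ofNat]
        calc 2 * ‖w1‖ ^ 3 * ‖v‖ ^ 3 ≤ 2 * (C * Q) ^ 3 * (Q ^ 4 / c) ^ 3 := by gcongr
          _ = 2 * C ^ 3 / c ^ 3 * Q ^ 15 := by ring
          _ ≤ _ := le_refl _
      have b4 : ‖w2‖ ≤ C * Q ^ 15 := h2.trans (by
        gcongr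
        calc Q = Q ^ 1 := by ring
          _ ≤ Q ^ 15 := hp 1 (by norm_num))
      calc ‖-w3 * v + 3 * w2 * w1 * v ^ 2 - 2 * w1 ^ 3 * v ^ 3 - w2‖
          ≤ ‖-w3 * v‖ + ‖3 * w2 * w1 * v ^ 2‖ + ‖2 * w1 ^ 3 * v ^ 3‖ + ‖w2‖ :=
            (norm_sub_le _ _).trans (add_le_add_left ((norm_sub_le _ _).trans
              (add_le_add_left (norm_add_le _ _) _)) _)
        _ ≤ L * Q ^ 15 := by rw [hL]; linarith
    have hQ15 : Q ^ 15 ≤ (1 + |s.im|) ^ (1 / 2 : ℝ) := by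
      rw [hQ, ← Real.rpow_natCast, ← Real.rpow_mul (abs_nonneg _)]
      calc |s.im| ^ (1 / 50 * ((15 : ℕ) : ℝ)) ≤ (1 + |s.im|) ^ (1 / 50 * ((15 : ℕ) : ℝ)) := by
            gcongr; linarith
        _ ≤ _ := Real.rpow_le_rpow_of_exponent_le (by linarith) (by norm_num)
    calc ‖deriv (deriv F) s‖ ≤ L * Q ^ 15 := hfin
      _ ≤ L * (1 + |s.im|) ^ (1 / 2 : ℝ) := by gcongr
      _ ≤ _ := by nlinarith

end LcmSum


namespace LcmSum
open Complex Filter Topology MeasureTheory ArithmeticFunction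

noncomputable def wt (u : ℝ) : ℂ := ((max (1 - u) 0 : ℝ) : ℂ)

lemma hasMellin_wt {s : ℂ} (hs : 0 < s.re) : HasMellin wt s (1 / s - 1 / (s + 1)) := by
  have h1 := hasMellin_one_Ioc hs
  have h2 := hasMellin_cpow_Ioc 1 (s := s) (by simp; linarith)
  have h3 := hasMellin_sub h1.1 h2.1
  rw [h1.2, h2.2] at h3
  have hco : ∀ t ∈ Set.Ioi (0 : ℝ), Set.indicator (Set.Ioc 0 1) (fun _ => (1 : ℂ)) t -
      Set.indicator (Set.Ioc 0 1) (fun t : ℝ => (t : ℂ) ^ (1 : ℂ)) t = wt t := by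
    intro t ht
    have ht0 : 0 < t := ht
    by_cases h : t ≤ 1
    · rw [Set.indicator_of_mem (show t ∈ Set.Ioc 0 1 from ⟨ht0, h⟩),
        Set.indicator_of_mem (show t ∈ Set.Ioc 0 1 from ⟨ht0, h⟩), wt, max_eq_left (by linarith)]
      simp
    · rw [Set.indicator_of_notMem (fun h' => h h'.2), Set.indicator_of_notMem (fun h' => h h'.2),
        wt, max_eq_right (by linarith)]
      simp
  refine ⟨?_, ?_⟩
  · refine (integrableOn_congr_fun (fun t ht => ?_) measurableSet_Ioi).1 h3.1
    simp only [← hco t ht]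
  · rw [← h3.2]
    refine setIntegral_congr_fun measurableSet_Ioi (fun t ht => ?_)
    simp only [← hco t ht]

lemma M_bound {σ : ℝ} (hσ : 1 < σ) (y : ℝ) :
    ‖1 / ((σ : ℂ) + y * I) - 1 / ((σ : ℂ) + y * I + 1)‖ ≤ (1 + y ^ 2)⁻¹ := by
  set s : ℂ := (σ : ℂ) + y * I with hs
  have hre : s.re = σ := by simp [hs]
  have him : s.im = y := by simp [hs]
  have h0 : s ≠ 0 := by intro h; rw [h] at hre; simp at hre; linarith
  have h1 : s + 1 ≠ 0 := by
    intro h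
    have : (s + 1).re = σ + 1 := by simp [hre]
    rw [h] at this; simp at this; linarith
  have e : 1 / s - 1 / (s + 1) = (s * (s + 1))⁻¹ := by field_simp; ring
  rw [e, norm_inv, norm_mul]
  have a1 : 1 + y ^ 2 ≤ ‖s‖ ^ 2 := by
    rw [Complex.sq_norm, normSq_apply, hre, him]; nlinarith
  have a2 : 1 + y ^ 2 ≤ ‖s + 1‖ ^ 2 := by
    rw [Complex.sq_norm, normSq_apply]
    simp only [add_re, one_re, add_im, one_im, hre, him]; nlinarith
  have a3 : 1 + y ^ 2 ≤ ‖s‖ * ‖s + 1‖ := by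
    refine le_of_pow_le_pow_left₀ (two_ne_zero) (by positivity) ?_
    rw [mul_pow, pow_two (1 + y ^ 2)]
    gcongr
  gcongr

lemma M_cont {σ : ℝ} (hσ : 1 < σ) :
    Continuous (fun y : ℝ => 1 / ((σ : ℂ) + y * I) - 1 / ((σ : ℂ) + y * I + 1)) := by
  have hre : ∀ y : ℝ, ((σ : ℂ) + y * I).re = σ := by intro y; simp
  refine Continuous.sub (Continuous.div continuous_const (by fun_prop) ?_)
    (Continuous.div continuous_const (by fun_prop) ?_)
  · intro y h
    have := hre y
    rw [h] at this; simp at this; linarith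
  · intro y h
    have : ((σ : ℂ) + y * I + 1).re = σ + 1 := by simp
    rw [h] at this; simp at this; linarith

lemma M_int {σ : ℝ} (hσ : 1 < σ) :
    Integrable (fun y : ℝ => 1 / ((σ : ℂ) + y * I) - 1 / ((σ : ℂ) + y * I + 1)) := by
  refine Integrable.mono' integrable_inv_one_add_sq (M_cont hσ).aestronglyMeasurable ?_
  exact Filter.Eventually.of_forall (fun y => M_bound hσ y)

lemma wt_inv {σ : ℝ} (hσ : 1 < σ) {u : ℝ} (hu : 0 < u) :
    ∫ y : ℝ, (u : ℂ) ^ (-((σ : ℂ) + y * I)) *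
      (1 / ((σ : ℂ) + y * I) - 1 / ((σ : ℂ) + y * I + 1)) = 2 * Real.pi * wt u := by
  have hm : ∀ y : ℝ, mellin wt ((σ : ℂ) + y * I) =
      1 / ((σ : ℂ) + y * I) - 1 / ((σ : ℂ) + y * I + 1) := fun y =>
    (hasMellin_wt (by simp; linarith)).2
  have h := mellinInv_mellin_eq σ wt hu (hasMellin_wt (by simp; linarith)).1 (by
    unfold VerticalIntegrable
    simp_rw [hm]
    exact M_int hσ) (by unfold wt; fun_prop)
  rw [mellinInv] at h
  simp_rw [hm, smul_eq_mul] at h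
  have hpi : (Real.pi : ℂ) ≠ 0 := by exact_mod_cast Real.pi_ne_zero
  rw [← h, real_smul]
  generalize (∫ y : ℝ, (u : ℂ) ^ (-((σ : ℂ) + y * I)) *
      (1 / ((σ : ℂ) + y * I) - 1 / ((σ : ℂ) + y * I + 1))) = T
  push_cast
  field_simp

noncomputable def b (n : ℕ) : ℂ := (vonMangoldt n : ℂ) - 1

lemma b_summable {s : ℂ} (hs : 1 < s.re) : LSeriesSummable b s := by
  have h1 := LSeriesSummable_vonMangoldt hs
  have h2 := LSeriesSummable_one_iff.2 hs
  exact h1.sub h2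

lemma b_abs : LSeries.abscissaOfAbsConv b ≤ 1 := by
  refine LSeries.abscissaOfAbsConv_le_of_forall_lt_LSeriesSummable (x := 1) ?_
  intro y hy
  exact b_summable (by simpa using hy)

lemma b_abs_lt {s : ℂ} (hs : 1 < s.re) : LSeries.abscissaOfAbsConv b < s.re :=
  lt_of_le_of_lt b_abs (by exact_mod_cast hs)

lemma b_LSeries {s : ℂ} (hs : 1 < s.re) : LSeries b s = F s := by
  have hne : s ≠ 1 := by rintro rfl; simp at hs
  rw [F_eq hs.le hne, ← LSeries_vonMangoldt_eq_deriv_riemannZeta_div hs,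
    ← LSeries_one_eq_riemannZeta hs]
  exact LSeries_sub (LSeriesSummable_vonMangoldt hs) (LSeriesSummable_one_iff.2 hs)

noncomputable def a : ℕ → ℂ := LSeries.logMul (LSeries.logMul b)

lemma a_LSeries {s : ℂ} (hs : 1 < s.re) : LSeries a s = deriv (deriv F) s := by
  have hopen : ∀ w : ℂ, 1 < w.re → ∀ᶠ z in 𝓝 w, 1 < z.re := fun w hw =>
    (isOpen_lt continuous_const continuous_re).mem_nhds hw
  have e1 : ∀ w : ℂ, 1 < w.re → deriv F w = -LSeries (LSeries.logMul b) w := by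
    intro w hw
    rw [← LSeries_deriv (b_abs_lt hw)]
    refine Filter.EventuallyEq.deriv_eq ?_
    filter_upwards [hopen w hw] with z hz
    rw [b_LSeries hz]
  have e2 : deriv F =ᶠ[𝓝 s] fun w => -LSeries (LSeries.logMul b) w := by
    filter_upwards [hopen s hs] with z hz
    exact e1 z hz
  rw [e2.deriv_eq, deriv.fun_neg, LSeries_deriv, neg_neg, a]
  rw [LSeries.abscissaOfAbsConv_logMul]
  exact b_abs_lt hs

lemma a_summable {s : ℂ} (hs : 1 < s.re) : LSeriesSummable a s := by
  apply LSeriesSummable_logMul_of_lt_re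
  rw [LSeries.abscissaOfAbsConv_logMul]
  exact b_abs_lt hs

lemma kernel_int : Integrable (fun y : ℝ => (1 + y ^ 2)⁻¹ * (1 + |y|) ^ (1 / 2 : ℝ)) := by
  have h : Integrable (fun y : ℝ => (1 + ‖y‖) ^ (-(3 / 2) : ℝ)) :=
    integrable_one_add_norm (by simp; norm_num)
  refine Integrable.mono' (h.const_mul 2) ?_ (Filter.Eventually.of_forall (fun y => ?_))
  · apply Continuous.aestronglyMeasurable
    refine Continuous.mul (Continuous.inv₀ (by fun_prop) (fun y => by positivity)) ?_
    exact Continuous.rpow_const (by fun_prop) (fun y => Or.inl (by positivity))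
  · have hy : 0 < 1 + |y| := by positivity
    rw [Real.norm_eq_abs, abs_of_nonneg (by positivity), Real.norm_eq_abs]
    have e : (1 + |y|) ^ (-(3 / 2) : ℝ) = (1 + |y|) ^ (1 / 2 : ℝ) / (1 + |y|) ^ 2 := by
      rw [← Real.rpow_natCast (1 + |y|) 2, ← Real.rpow_sub hy]; norm_num
    have h2 : (1 + y ^ 2)⁻¹ ≤ 2 / (1 + |y|) ^ 2 := by
      rw [inv_eq_one_div, div_le_div_iff₀ (by positivity) (by positivity)]
      nlinarith [sq_nonneg (1 - |y|), sq_abs y]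
    rw [e]
    calc (1 + y ^ 2)⁻¹ * (1 + |y|) ^ (1 / 2 : ℝ) ≤ 2 / (1 + |y|) ^ 2 * (1 + |y|) ^ (1 / 2 : ℝ) := by
          gcongr
      _ = _ := by ring

lemma perron {x σ : ℝ} (hx : 0 < x) (hσ : 1 < σ) :
    HasSum (fun n : ℕ => a n * (2 * Real.pi * wt (n / x)))
      (∫ y : ℝ, (x : ℂ) ^ ((σ : ℂ) + y * I) *
        (1 / ((σ : ℂ) + y * I) - 1 / ((σ : ℂ) + y * I + 1)) * deriv (deriv F) ((σ : ℂ) + y * I)) := by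
  have hre : ∀ y : ℝ, ((σ : ℂ) + y * I).re = σ := by intro y; simp
  set M : ℝ → ℂ := fun y => 1 / ((σ : ℂ) + y * I) - 1 / ((σ : ℂ) + y * I + 1) with hM
  set G : ℕ → ℝ → ℂ := fun n y =>
    (x : ℂ) ^ ((σ : ℂ) + y * I) * M y * LSeries.term a ((σ : ℂ) + y * I) n with hG
  have hx0 : (x : ℂ) ≠ 0 := by exact_mod_cast hx.ne'
  have hxn : ∀ y : ℝ, ‖(x : ℂ) ^ ((σ : ℂ) + y * I)‖ = x ^ σ := by
    intro y
    rw [norm_cpow_eq_rpow_re_of_pos hx, hre]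
  have hnorm : ∀ n y, ‖G n y‖ = x ^ σ * ‖LSeries.term a σ n‖ * ‖M y‖ := by
    intro n y
    simp only [hG, norm_mul, hxn, LSeries.norm_term_eq, hre, ofReal_re]
    ring
  have hterm : ∀ n, Continuous (fun y : ℝ => LSeries.term a ((σ : ℂ) + y * I) n) := by
    intro n
    rcases eq_or_ne n 0 with rfl | hn
    · simp [LSeries.term_zero, continuous_const]
    · simp_rw [LSeries.term_of_ne_zero hn]
      have hn0 : (n : ℂ) ≠ 0 := by exact_mod_cast hn
      refine Continuous.div continuous_const ?_ (fun y => ?_)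
      · exact Continuous.const_cpow (by fun_prop) (Or.inl hn0)
      · simp [cpow_eq_zero_iff, hn0]
  have hint : ∀ n, Integrable (G n) := by
    intro n
    refine Integrable.mono' ((M_int hσ).norm.const_mul (x ^ σ * ‖LSeries.term a σ n‖)) ?_
      (Filter.Eventually.of_forall (fun y => (hnorm n y).le))
    exact (((Continuous.const_cpow (by fun_prop) (Or.inl hx0)).mul (M_cont hσ)).mul
      (hterm n)).aestronglyMeasurable
  have hsum : Summable (fun n => ∫ y, ‖G n y‖) := by
    simp_rw [hnorm, integral_const_mul]
    exact ((a_summable (s := σ) (by simpa using hσ)).norm.mul_left _).mul_right _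
  have key := hasSum_integral_of_summable_integral_norm hint hsum
  have e1 : (fun n : ℕ => a n * (2 * Real.pi * wt (n / x))) = fun n => ∫ y, G n y := by
    funext n
    rcases eq_or_ne n 0 with rfl | hn
    · simp [hG, a, LSeries.logMul]
    · have hn0 : (0 : ℝ) < n := by exact_mod_cast Nat.pos_of_ne_zero hn
      rw [← wt_inv hσ (u := n / x) (by positivity), ← integral_const_mul]
      congr 1
      funext y
      simp only [hG, LSeries.term_of_ne_zero hn]
      rw [cpow_neg, ofReal_div, div_cpow_ofReal_nonneg hn0.le hx.le, inv_div, ofReal_natCast]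
      ring
  have e2 : (∫ y : ℝ, (x : ℂ) ^ ((σ : ℂ) + y * I) * M y * deriv (deriv F) ((σ : ℂ) + y * I)) =
      ∫ y, ∑' n, G n y := by
    congr 1
    funext y
    simp only [hG]
    rw [tsum_mul_left]
    congr 1
    exact (a_LSeries (by simpa using hσ)).symm
  rw [e1]
  exact e2 ▸ key

lemma smooth_bound : ∃ C : ℝ, 0 < C ∧ ∀ x : ℝ, 3 ≤ x →
    |∑ n ∈ Finset.Icc 1 ⌊x⌋₊, (vonMangoldt n - 1) * Real.log n ^ 2 * (x - n)| ≤ C * x ^ 2 := by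
  obtain ⟨C, hC0, hC⟩ := F_bound
  set J := ∫ y : ℝ, (1 + y ^ 2)⁻¹ * (1 + |y|) ^ (1 / 2 : ℝ) with hJ
  have hJ0 : 0 ≤ J := integral_nonneg (fun y => by positivity)
  refine ⟨Real.exp 1 * C * J + 1, by positivity, fun x hx => ?_⟩
  have hx0 : 0 < x := by linarith
  have hlog : 1 < Real.log x := by
    rw [Real.lt_log_iff_exp_lt hx0]
    linarith [Real.exp_one_lt_d9]
  set σ : ℝ := 1 + 1 / Real.log x with hσ
  have hσ1 : 1 < σ := by
    have : 0 < 1 / Real.log x := by positivity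
    linarith
  have hσ2 : σ ≤ 2 := by
    have : 1 / Real.log x ≤ 1 := by rw [div_le_one (by linarith)]; exact hlog.le
    linarith
  have hxσ : x ^ σ = Real.exp 1 * x := by
    rw [hσ, Real.rpow_add hx0, Real.rpow_one, Real.rpow_def_of_pos hx0]
    rw [mul_one_div_cancel (by linarith)]
    ring
  have hP := perron hx0 hσ1
  have hre : ∀ y : ℝ, ((σ : ℂ) + y * I).re = σ := by intro y; simp
  have him : ∀ y : ℝ, ((σ : ℂ) + y * I).im = y := by intro y; simp
  have hfin : ∑' n : ℕ, a n * (2 * Real.pi * wt (n / x)) =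
      ((2 * Real.pi / x * ∑ n ∈ Finset.Icc 1 ⌊x⌋₊,
        (vonMangoldt n - 1) * Real.log n ^ 2 * (x - n) : ℝ) : ℂ) := by
    rw [tsum_eq_sum (s := Finset.Icc 1 ⌊x⌋₊)]
    · rw [Finset.mul_sum]
      push_cast
      refine Finset.sum_congr rfl (fun n hn => ?_)
      rw [Finset.mem_Icc] at hn
      have hnx : (n : ℝ) ≤ x := (Nat.le_floor_iff hx0.le).1 hn.2
      have : wt (n / x) = 1 - n / x := by
        rw [wt, max_eq_left (by rw [sub_nonneg, div_le_one hx0]; exact hnx)]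
        push_cast; rfl
      rw [this]
      have hxc : (x : ℂ) ≠ 0 := by exact_mod_cast hx0.ne'
      simp only [a, LSeries.logMul, b]
      rw [← ofReal_natCast, ← ofReal_log (by positivity)]
      field_simp
    · intro n hn
      rw [Finset.mem_Icc, not_and_or] at hn
      rcases hn with hn | hn
      · have : n = 0 := by omega
        subst this
        simp [a, LSeries.logMul]
      · have hnx : x < n := by
          rw [not_le] at hn
          exact (Nat.floor_lt hx0.le).1 hn
        have : wt (n / x) = 0 := by
          rw [wt, max_eq_right (by rw [sub_nonpos, one_le_div hx0]; exact hnx.le)]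
          simp
        simp [this]
  rw [hP.tsum_eq] at hfin
  have hb : ‖∫ y : ℝ, (x : ℂ) ^ ((σ : ℂ) + y * I) *
        (1 / ((σ : ℂ) + y * I) - 1 / ((σ : ℂ) + y * I + 1)) * deriv (deriv F) ((σ : ℂ) + y * I)‖
      ≤ (Real.exp 1 * x * C) * J := by
    rw [hJ, ← integral_const_mul]
    refine norm_integral_le_of_norm_le (kernel_int.const_mul _)
      (Filter.Eventually.of_forall (fun y => ?_))
    rw [norm_mul, norm_mul, norm_cpow_eq_rpow_re_of_pos hx0, hre, hxσ]
    have h1 := hC ((σ : ℂ) + y * I) (by rw [hre]; exact hσ1) (by rw [hre]; exact hσ2)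
    rw [him] at h1
    calc _ ≤ Real.exp 1 * x * (1 + y ^ 2)⁻¹ * (C * (1 + |y|) ^ (1 / 2 : ℝ)) := by
          gcongr
          exact M_bound hσ1 y
      _ = _ := by ring
  rw [hfin, norm_real, Real.norm_eq_abs, abs_mul, abs_of_pos (by positivity)] at hb
  set S := |∑ n ∈ Finset.Icc 1 ⌊x⌋₊, (vonMangoldt n - 1) * Real.log n ^ 2 * (x - n)| with hS
  have hS0 : 0 ≤ S := abs_nonneg _
  have h2 : 1 ≤ 2 * Real.pi := by linarith [Real.pi_gt_three]
  have h3 : S ≤ 2 * Real.pi * S := by nlinarith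
  have h4 : 2 * Real.pi * S ≤ (Real.exp 1 * x * C) * J * x := by
    rw [div_mul_eq_mul_div, div_le_iff₀ hx0] at hb
    exact hb
  nlinarith [sq_nonneg x]

end LcmSum


namespace LcmSum
open Finset ArithmeticFunction

noncomputable def u (n : ℕ) : ℝ := (vonMangoldt n - 1) * Real.log n ^ 2
noncomputable def U (N : ℕ) : ℝ := ∑ n ∈ Icc 1 N, u n
noncomputable def E (N : ℕ) : ℝ := ∑ n ∈ Icc 1 N, u n * ((N : ℝ) - n)

lemma E_bound : ∃ C : ℝ, 0 < C ∧ ∀ N : ℕ, 3 ≤ N → |E N| ≤ C * (N : ℝ) ^ 2 := by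
  obtain ⟨C, h0, h⟩ := smooth_bound
  refine ⟨C, h0, fun N hN => ?_⟩
  have := h N (by exact_mod_cast hN)
  rwa [Nat.floor_natCast] at this

lemma u_lower (n M : ℕ) (hn : 1 ≤ n) (h : n ≤ M) : -(Real.log M ^ 2) ≤ u n := by
  have h1 : (1 : ℝ) ≤ n := by exact_mod_cast hn
  have h2 : Real.log n ≤ Real.log M := Real.log_le_log (by linarith) (by exact_mod_cast h)
  have h3 := Real.log_nonneg h1
  have h4 : Real.log n ^ 2 ≤ Real.log M ^ 2 := by gcongr
  have h5 : 0 ≤ vonMangoldt n := vonMangoldt_nonneg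
  unfold u
  nlinarith [mul_nonneg h5 (sq_nonneg (Real.log n))]

lemma split_sum (g : ℕ → ℝ) (N h : ℕ) :
    ∑ n ∈ Icc 1 (N + h), g n = ∑ n ∈ Icc 1 N, g n + ∑ n ∈ Ioc N (N + h), g n := by
  rw [← sum_union]
  · congr 1
    ext n; simp only [mem_Icc, mem_union, mem_Ioc]; omega
  · rw [Finset.disjoint_left]
    intro n; simp only [mem_Icc, mem_Ioc]; omega

lemma E_add1 (N h : ℕ) :
    h * U N ≤ E (N + h) - E N + (h : ℝ) ^ 2 * Real.log ((N + h : ℕ) : ℝ) ^ 2 := by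
  have e : E (N + h) = E N + h * U N + ∑ n ∈ Ioc N (N + h), u n * (((N + h : ℕ) : ℝ) - n) := by
    unfold E U
    rw [split_sum, mul_sum, ← sum_add_distrib]
    congr 1
    refine sum_congr rfl (fun n _ => ?_)
    push_cast; ring
  have l : -((h : ℝ) ^ 2 * Real.log ((N + h : ℕ) : ℝ) ^ 2) ≤
      ∑ n ∈ Ioc N (N + h), u n * (((N + h : ℕ) : ℝ) - n) := by
    have : ∑ n ∈ Ioc N (N + h), (-((h : ℝ) * Real.log ((N + h : ℕ) : ℝ) ^ 2)) ≤
      ∑ n ∈ Ioc N (N + h), u n * (((N + h : ℕ) : ℝ) - n) := by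
      refine sum_le_sum (fun n hn => ?_)
      rw [mem_Ioc] at hn
      have h1 := u_lower n (N + h) (by omega) hn.2
      have h2 : (0 : ℝ) ≤ ((N + h : ℕ) : ℝ) - n := by
        rw [sub_nonneg]; exact_mod_cast hn.2
      have h3 : ((N + h : ℕ) : ℝ) - n ≤ h := by
        have : (N : ℝ) ≤ n := by exact_mod_cast hn.1.le
        push_cast; linarith
      nlinarith [mul_le_mul_of_nonneg_right h1 h2,
        mul_le_mul_of_nonneg_right h3 (sq_nonneg (Real.log ((N + h : ℕ) : ℝ)))]
    rw [sum_const, Nat.card_Ioc, nsmul_eq_mul] at this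
    simp only [Nat.add_sub_cancel_left] at this
    linarith
  linarith

lemma E_add2 (N h : ℕ) :
    E (N + h) - E N - (h : ℝ) ^ 2 * Real.log ((N + h : ℕ) : ℝ) ^ 2 ≤ h * U (N + h) := by
  have e : h * U (N + h) = E (N + h) - E N + ∑ n ∈ Ioc N (N + h), u n * (n - N) := by
    unfold E U
    rw [split_sum, split_sum, mul_add, mul_sum, mul_sum, add_sub_right_comm, ← sum_sub_distrib,
      add_assoc, ← sum_add_distrib]
    congr 1
    · refine sum_congr rfl (fun n _ => ?_)
      push_cast; ring
    · refine sum_congr rfl (fun n _ => ?_)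
      push_cast; ring
  have l : -((h : ℝ) ^ 2 * Real.log ((N + h : ℕ) : ℝ) ^ 2) ≤
      ∑ n ∈ Ioc N (N + h), u n * (n - N) := by
    have : ∑ n ∈ Ioc N (N + h), (-((h : ℝ) * Real.log ((N + h : ℕ) : ℝ) ^ 2)) ≤
      ∑ n ∈ Ioc N (N + h), u n * (n - N) := by
      refine sum_le_sum (fun n hn => ?_)
      rw [mem_Ioc] at hn
      have h1 := u_lower n (N + h) (by omega) hn.2
      have h2 : (0 : ℝ) ≤ (n : ℝ) - N := by
        rw [sub_nonneg]; exact_mod_cast hn.1.le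
      have h3 : (n : ℝ) - N ≤ h := by
        have : (n : ℝ) ≤ ((N + h : ℕ) : ℝ) := by exact_mod_cast hn.2
        push_cast at this; linarith
      nlinarith [mul_le_mul_of_nonneg_right h1 h2,
        mul_le_mul_of_nonneg_right h3 (sq_nonneg (Real.log ((N + h : ℕ) : ℝ)))]
    rw [sum_const, Nat.card_Ioc, nsmul_eq_mul] at this
    simp only [Nat.add_sub_cancel_left] at this
    linarith
  linarith

lemma log_hundred {N : ℕ} (hN : 100 ≤ N) : 4 ≤ Real.log N := by
  have : (100 : ℝ) ≤ N := by exact_mod_cast hN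
  rw [Real.le_log_iff_exp_le (by linarith)]
  have h := Real.exp_one_lt_d9
  have : Real.exp 4 = (Real.exp 1) ^ 4 := by rw [← Real.exp_nat_mul]; norm_num
  rw [this]
  calc (Real.exp 1) ^ 4 ≤ 2.7182818286 ^ 4 := by gcongr
    _ ≤ 100 := by norm_num
    _ ≤ _ := by linarith

lemma U_bound : ∃ C : ℝ, 0 < C ∧ ∀ N : ℕ, 100 ≤ N → |U N| ≤ C * (N * Real.log N) := by
  obtain ⟨C, h0, hE⟩ := E_bound
  refine ⟨5 * C + 8, by positivity, fun N hN => ?_⟩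
  have hl := log_hundred hN
  have hNr : (100 : ℝ) ≤ N := by exact_mod_cast hN
  set L := Real.log N with hL
  set h := ⌈(N : ℝ) / L⌉₊ with hh
  have a1 : (N : ℝ) / L ≤ h := Nat.le_ceil _
  have hLN : L ≤ N := by
    have := Real.log_le_sub_one_of_pos (show (0 : ℝ) < N by linarith)
    linarith
  have a2 : (h : ℝ) ≤ 2 * (N / L) := by
    have h1 : (h : ℝ) < N / L + 1 := Nat.ceil_lt_add_one (by positivity)
    have h2 : 1 ≤ (N : ℝ) / L := by rw [one_le_div (by linarith)]; exact hLN
    linarith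
  have a3 : (h : ℝ) ≤ N / 2 := by
    refine a2.trans ?_
    rw [← mul_div_assoc, div_le_div_iff₀ (by linarith) (by norm_num)]
    nlinarith
  have hpos : (0 : ℝ) < h := lt_of_lt_of_le (by positivity) a1
  have a4 : (N : ℝ) ≤ h * L := by
    rw [div_le_iff₀ (by linarith)] at a1; exact a1
  have a5 : (h : ℝ) * L ≤ 2 * N := by
    rw [← mul_div_assoc, le_div_iff₀ (by linarith)] at a2; exact a2
  have hNh : 2 * h ≤ N := by
    have : (2 : ℝ) * h ≤ N := by linarith
    exact_mod_cast this
  -- upper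
  have b1 := E_add1 N h
  have b2 := abs_le.1 (hE N (by omega))
  have b3 := abs_le.1 (hE (N + h) (by omega))
  have c1 : ((N + h : ℕ) : ℝ) ≤ 3 / 2 * N := by push_cast; linarith
  have c2 : Real.log ((N + h : ℕ) : ℝ) ≤ 2 * L := by
    rw [hL, ← Real.log_rpow (by linarith)]
    refine Real.log_le_log (by push_cast; linarith) ?_
    rw [Real.rpow_two]; nlinarith
  have c0 : 0 ≤ Real.log ((N + h : ℕ) : ℝ) := Real.log_natCast_nonneg _
  have c3 : Real.log ((N + h : ℕ) : ℝ) ^ 2 ≤ 4 * L ^ 2 := by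
    nlinarith
  have c4 : ((N + h : ℕ) : ℝ) ^ 2 ≤ 9 / 4 * (N : ℝ) ^ 2 := by
    have : (0 : ℝ) ≤ ((N + h : ℕ) : ℝ) := by positivity
    nlinarith
  have c5 : (N : ℝ) ^ 2 ≤ h * (N * L) := by nlinarith
  have c6 : (h : ℝ) ^ 2 * L ^ 2 ≤ h * (2 * (N * L)) := by
    have : (h * L) * (h * L) ≤ (h * L) * (2 * N) := by gcongr
    nlinarith
  have up : U N ≤ (5 * C + 8) * (N * L) := by
    have : (h : ℝ) * U N ≤ h * ((5 * C + 8) * (N * L)) := by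
      have d1 : E (N + h) - E N ≤ 4 * (C * (N : ℝ) ^ 2) := by nlinarith [b3.2, b2.1]
      have d2 : (h : ℝ) ^ 2 * Real.log ((N + h : ℕ) : ℝ) ^ 2 ≤ (h : ℝ) ^ 2 * (4 * L ^ 2) := by gcongr
      have d3 : C * (N : ℝ) ^ 2 ≤ C * (h * (N * L)) := by gcongr
      have d4 : 0 ≤ C * (h * (N * L)) := by positivity
      nlinarith
    exact le_of_mul_le_mul_left this hpos
  have lo : -((5 * C + 8) * (N * L)) ≤ U N := by
    have b1 := E_add2 (N - h) h
    rw [Nat.sub_add_cancel (by omega), ← hL] at b1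
    have b4 := abs_le.1 (hE (N - h) (by omega))
    have b5 : ((N - h : ℕ) : ℝ) ≤ N := by exact_mod_cast Nat.sub_le _ _
    have b6 : ((N - h : ℕ) : ℝ) ^ 2 ≤ (N : ℝ) ^ 2 := by gcongr
    have : (h : ℝ) * -((5 * C + 8) * (N * L)) ≤ h * U N := by
      have d1 : - (2 * (C * (N : ℝ) ^ 2)) ≤ E N - E (N - h) := by
        have := mul_le_mul_of_nonneg_left b6 h0.le
        linarith [b4.2, b2.1]
      have d3 : C * (N : ℝ) ^ 2 ≤ C * (h * (N * L)) := by gcongr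
      have d4 : 0 ≤ C * (h * (N * L)) := by positivity
      have d5 : 0 ≤ (h * (N * L)) := by positivity
      have d6 : (h : ℝ) * -((5 * C + 8) * (N * L)) =
        -(5 * (C * (h * (N * L))) + 8 * (h * (N * L))) := by ring
      rw [d6]
      linarith
    exact le_of_mul_le_mul_left this hpos
  exact abs_le.2 ⟨lo, up⟩

noncomputable def psiN (N : ℕ) : ℝ := ∑ n ∈ Icc 1 N, vonMangoldt n

lemma psiN_eq (N : ℕ) : psiN N = Chebyshev.psi N := by
  unfold psiN Chebyshev.psi
  rw [Nat.floor_natCast]; rfl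

lemma A_bound : ∃ C : ℝ, 0 < C ∧ ∀ N : ℕ,
    ∑ n ∈ Icc 1 N, (vonMangoldt n + 1) * (Real.log N - Real.log n) ≤ C * N := by
  refine ⟨Real.log 4 + 4 + 1, by positivity, fun N => ?_⟩
  induction N with
  | zero => simp
  | succ N ih =>
    rcases Nat.eq_zero_or_pos N with rfl | hN
    · simp; positivity
    have hNr : (0 : ℝ) < N := by exact_mod_cast hN
    rw [Finset.sum_Icc_succ_top (by omega)]
    have e : ∑ n ∈ Icc 1 N, (vonMangoldt n + 1) * (Real.log ((N + 1 : ℕ) : ℝ) - Real.log n) =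
      ∑ n ∈ Icc 1 N, (vonMangoldt n + 1) * (Real.log N - Real.log n) +
      (psiN N + N) * (Real.log ((N + 1 : ℕ) : ℝ) - Real.log N) := by
      have : psiN N + N = ∑ n ∈ Icc 1 N, (vonMangoldt n + 1) := by
        rw [sum_add_distrib]; simp [psiN]
      rw [this, sum_mul, ← sum_add_distrib]
      refine sum_congr rfl (fun n _ => by ring)
    rw [e]
    have h1 : Real.log ((N + 1 : ℕ) : ℝ) - Real.log N ≤ 1 / N := by
      rw [← Real.log_div (by positivity) (by positivity)]
      have := Real.log_le_sub_one_of_pos (show (0 : ℝ) < ((N + 1 : ℕ) : ℝ) / N by positivity)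
      refine this.trans (le_of_eq ?_)
      push_cast; field_simp; ring
    have h2 : psiN N ≤ (Real.log 4 + 4) * N := by
      rw [psiN_eq]; exact Chebyshev.psi_le_const_mul_self (by positivity)
    have h3 : 0 ≤ psiN N := sum_nonneg (fun n _ => vonMangoldt_nonneg)
    have h4 : (psiN N + N) * (Real.log ((N + 1 : ℕ) : ℝ) - Real.log N) ≤ Real.log 4 + 4 + 1 := by
      calc _ ≤ (psiN N + N) * (1 / N) := by gcongr
        _ ≤ ((Real.log 4 + 4) * N + N) * (1 / N) := by gcongr
        _ = _ := by field_simp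
    simp only [sub_self, mul_zero, add_zero]
    push_cast at *
    linarith

lemma psi_bound : ∃ C : ℝ, 0 < C ∧ ∀ N : ℕ, 100 ≤ N → |psiN N - N| ≤ C * (N / Real.log N) := by
  obtain ⟨C1, h1, hU⟩ := U_bound
  obtain ⟨C2, h2, hA⟩ := A_bound
  refine ⟨C1 + 2 * C2, by positivity, fun N hN => ?_⟩
  have hl := log_hundred hN
  have hNr : (100 : ℝ) ≤ N := by exact_mod_cast hN
  have hU := hU N hN
  have hA := hA N
  set L := Real.log N with hL
  have e : (psiN N - N) * L ^ 2 = U N +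
      ∑ n ∈ Icc 1 N, (vonMangoldt n - 1) * (L ^ 2 - Real.log n ^ 2) := by
    have : psiN N - N = ∑ n ∈ Icc 1 N, (vonMangoldt n - 1) := by
      rw [sum_sub_distrib]; simp [psiN]
    rw [this, sum_mul, U, ← sum_add_distrib]
    refine sum_congr rfl (fun n _ => by unfold u; ring)
  have h3 : |∑ n ∈ Icc 1 N, (vonMangoldt n - 1) * (L ^ 2 - Real.log n ^ 2)| ≤
      2 * L * (C2 * N) := by
    refine (abs_sum_le_sum_abs _ _).trans ?_
    refine le_trans ?_ (mul_le_mul_of_nonneg_left hA (by linarith))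
    rw [mul_sum]
    refine sum_le_sum (fun n hn => ?_)
    rw [mem_Icc] at hn
    have g1 : (1 : ℝ) ≤ n := by exact_mod_cast hn.1
    have g2 : Real.log n ≤ L := Real.log_le_log (by linarith) (by exact_mod_cast hn.2)
    have g3 := Real.log_nonneg g1
    have g4 : 0 ≤ vonMangoldt n := vonMangoldt_nonneg
    have g5 : L ^ 2 - Real.log n ^ 2 = (L - Real.log n) * (L + Real.log n) := by ring
    rw [abs_mul, g5, abs_of_nonneg (mul_nonneg (sub_nonneg.2 g2) (by linarith))]
    have g6 : |vonMangoldt n - 1| ≤ vonMangoldt n + 1 := by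
      rw [abs_le]; constructor <;> linarith
    have g7 : 0 ≤ L - Real.log n := by linarith
    calc _ ≤ (vonMangoldt n + 1) * ((L - Real.log n) * (L + L)) := by gcongr
      _ = _ := by ring
  have h4 : |(psiN N - N)| * L ^ 2 ≤ (C1 + 2 * C2) * (N * L) := by
    rw [← abs_of_nonneg (sq_nonneg L), ← abs_mul, e]
    refine (abs_add_le _ _).trans ?_
    linarith
  rw [← mul_div_assoc, le_div_iff₀ (by linarith)]
  refine le_of_mul_le_mul_right ?_ (show (0:ℝ) < L by linarith)
  calc _ = |(psiN N - N)| * L ^ 2 := by ring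
    _ ≤ _ := h4
    _ = _ := by ring

end LcmSum


namespace LcmSum
open Finset ArithmeticFunction

noncomputable def th (N : ℕ) : ℝ := ∑ p ∈ Icc 1 N with p.Prime, Real.log p
noncomputable def W (N : ℕ) : ℝ := ∑ p ∈ Icc 1 N with p.Prime, (p : ℝ) * Real.log p
noncomputable def PP (N : ℕ) : ℝ := ∑ p ∈ Icc 1 N with p.Prime, (p : ℝ)

lemma th_eq (N : ℕ) : th N = Chebyshev.theta N := by
  unfold th Chebyshev.theta
  rw [Nat.floor_natCast]; rfl

lemma log_le_two_sqrt {x : ℝ} (hx : 0 < x) : Real.log x ≤ 2 * √x := by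
  have := Real.log_le_sub_one_of_pos (Real.sqrt_pos.2 hx)
  rw [Real.log_sqrt hx.le] at this
  linarith

lemma th_bound : ∃ C : ℝ, 0 < C ∧ ∀ N : ℕ, 2 ≤ N → |th N - N| ≤ C * (N / Real.log N) := by
  obtain ⟨C1, h1, hpsi⟩ := psi_bound
  obtain ⟨C2, hC2⟩ := Chebyshev.psi_sub_theta_le_mul_sqrt
  refine ⟨C1 + 2 * |C2| + (Real.log 4 + 1) * Real.log 100, by positivity, fun N hN => ?_⟩
  have hNr : (2 : ℝ) ≤ N := by exact_mod_cast hN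
  have hL : 0 < Real.log N := Real.log_pos (by linarith)
  have hq : 0 ≤ N / Real.log N := by positivity
  rcases le_or_gt 100 N with h | h
  · have a1 := abs_le.1 (hpsi N h)
    rw [psiN_eq] at a1
    have a2 := hC2 N
    have a3 := Chebyshev.theta_le_psi N
    rw [← th_eq] at a2 a3
    have a4 : C2 * √N ≤ 2 * |C2| * (N / Real.log N) := by
      have : √N ≤ 2 * (N / Real.log N) := by
        rw [← mul_div_assoc, le_div_iff₀ hL]
        have h1 := log_le_two_sqrt (show (0 : ℝ) < N by linarith)
        have h2 := Real.mul_self_sqrt (show (0 : ℝ) ≤ N by linarith)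
        nlinarith [Real.sqrt_nonneg (N : ℝ)]
      calc C2 * √N ≤ |C2| * √N := by gcongr; exact le_abs_self _
        _ ≤ |C2| * (2 * (N / Real.log N)) := by gcongr
        _ = _ := by ring
    have a5 : 0 ≤ (Real.log 4 + 1) * Real.log 100 * (N / Real.log N) := by positivity
    have a6 : 0 ≤ 2 * |C2| * (N / Real.log N) := by positivity
    rw [add_mul, add_mul, abs_le]
    constructor <;> linarith
  · have b1 : |th N - N| ≤ (Real.log 4 + 1) * N := by
      have := Chebyshev.theta_le_log4_mul_x (show (0 : ℝ) ≤ N by linarith)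
      have h2 := Chebyshev.theta_nonneg (N : ℝ)
      rw [← th_eq] at this h2
      have h4 : 0 ≤ Real.log 4 := Real.log_nonneg (by norm_num)
      rw [abs_le]; constructor <;> nlinarith
    have b2 : (N : ℝ) ≤ Real.log 100 * (N / Real.log N) := by
      rw [← mul_div_assoc, le_div_iff₀ hL, mul_comm]
      have : Real.log N ≤ Real.log 100 := Real.log_le_log (by linarith) (by exact_mod_cast h.le)
      gcongr
    have h4 : 0 ≤ Real.log 4 := Real.log_nonneg (by norm_num)
    have : 0 ≤ (C1 + 2 * |C2|) * (N / Real.log N) := by positivity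
    calc _ ≤ _ := b1
      _ ≤ (Real.log 4 + 1) * (Real.log 100 * (N / Real.log N)) := by gcongr
      _ ≤ _ := by rw [add_mul]; linarith

lemma W_abel (N : ℕ) : W N = N * th N - ∑ n ∈ range N, th n := by
  induction N with
  | zero => simp [W, th]
  | succ N ih =>
    rw [sum_range_succ]
    by_cases hp : (N + 1).Prime
    · have e1 : W (N + 1) = W N + ((N + 1 : ℕ) : ℝ) * Real.log ((N + 1 : ℕ) : ℝ) := by
        unfold W
        simp only [sum_filter]
        rw [sum_Icc_succ_top (by omega), if_pos hp]
      have e2 : th (N + 1) = th N + Real.log ((N + 1 : ℕ) : ℝ) := by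
        unfold th
        simp only [sum_filter]
        rw [sum_Icc_succ_top (by omega), if_pos hp]
      rw [e1, e2, ih]; push_cast; ring
    · have e1 : W (N + 1) = W N := by
        unfold W
        simp only [sum_filter]
        rw [sum_Icc_succ_top (by omega), if_neg hp, add_zero]
      have e2 : th (N + 1) = th N := by
        unfold th
        simp only [sum_filter]
        rw [sum_Icc_succ_top (by omega), if_neg hp, add_zero]
      rw [e1, e2, ih]; push_cast; ring

lemma log2_gt : (1 : ℝ) / 2 < Real.log 2 := by linarith [Real.log_two_gt_d9]

lemma div_log_mono {n N : ℕ} (hn : 2 ≤ n) (h : n ≤ N) :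
    (n : ℝ) / Real.log n ≤ 3 * (N / Real.log N) := by
  have hn' : (2 : ℝ) ≤ n := by exact_mod_cast hn
  have hN' : (n : ℝ) ≤ N := by exact_mod_cast h
  have l1 : Real.log 2 ≤ Real.log n := Real.log_le_log (by norm_num) hn'
  have l2 : Real.log n ≤ Real.log N := Real.log_le_log (by linarith) hN'
  have := log2_gt
  rw [← mul_div_assoc, div_le_div_iff₀ (by linarith) (by linarith)]
  have h1 := Real.log_le_sub_one_of_pos (show (0 : ℝ) < N / n from div_pos (by linarith) (by linarith))
  rw [Real.log_div (by linarith) (by linarith)] at h1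
  have h2 : (n : ℝ) * (Real.log N - Real.log n) ≤ N := by
    calc (n : ℝ) * (Real.log N - Real.log n) ≤ n * (N / n) := by gcongr; linarith
      _ = N := by field_simp
  nlinarith

lemma one_le_div_log {N : ℕ} (hn : 2 ≤ N) : 1 ≤ (N : ℝ) / Real.log N := by
  have hn' : (2 : ℝ) ≤ N := by exact_mod_cast hn
  rw [one_le_div (Real.log_pos (by linarith))]
  linarith [Real.log_le_sub_one_of_pos (show (0 : ℝ) < N by linarith)]

lemma W_bound : ∃ C : ℝ, 0 < C ∧ ∀ N : ℕ, 2 ≤ N →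
    |W N - N ^ 2 / 2| ≤ C * (N ^ 2 / Real.log N) := by
  obtain ⟨C, hC, hth⟩ := th_bound
  refine ⟨4 * C + 2, by positivity, fun N hN => ?_⟩
  have hNr : (2 : ℝ) ≤ N := by exact_mod_cast hN
  set D := (N : ℝ) / Real.log N with hD
  have hD1 : 1 ≤ D := one_le_div_log hN
  have e : W N - N ^ 2 / 2 = N * (th N - N) - ∑ n ∈ range N, (th n - n) + N / 2 := by
    have g : ∑ n ∈ range N, (n : ℝ) = N * (N - 1) / 2 := by
      clear hD1 hD D hNr hN
      induction N with
      | zero => simp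
      | succ N ih => rw [sum_range_succ, ih]; push_cast; ring
    rw [sum_sub_distrib, g, W_abel]; ring
  have s : |∑ n ∈ range N, (th n - n)| ≤ N * ((3 * C + 1) * D) := by
    refine (abs_sum_le_sum_abs _ _).trans ?_
    have : ∑ n ∈ range N, |th n - n| ≤ ∑ n ∈ range N, (3 * C + 1) * D := by
      refine sum_le_sum (fun n hn => ?_)
      rw [mem_range] at hn
      rcases Nat.lt_or_ge n 2 with h2 | h2
      · have : |th n - n| ≤ 1 := by
          interval_cases n <;> simp [th, sum_filter]
        have : 0 ≤ C * D := by positivity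
        nlinarith
      · have h3 := hth n h2
        have h4 := div_log_mono h2 hn.le
        have : C * (n / Real.log n) ≤ C * (3 * D) := by gcongr
        nlinarith
    simpa using this
  have f := hth N hN
  have eD : (N : ℝ) ^ 2 / Real.log N = N * D := by rw [hD]; ring
  rw [e, eD]
  have t1 : |N * (th N - N)| ≤ N * (C * D) := by
    rw [abs_mul, abs_of_nonneg (by linarith)]; gcongr
  have a1 := abs_le.1 s
  have a2 := abs_le.1 t1
  have a3 : (N : ℝ) ≤ N * D := by nlinarith
  rw [abs_le]
  constructor <;> nlinarith

lemma PP_nonneg (N : ℕ) : 0 ≤ PP N := sum_nonneg (fun n _ => by positivity)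

lemma PP_le (N : ℕ) : PP N ≤ N ^ 2 := by
  unfold PP
  calc ∑ p ∈ Icc 1 N with p.Prime, (p : ℝ) ≤ ∑ p ∈ Icc 1 N, (p : ℝ) :=
        sum_le_sum_of_subset_of_nonneg (filter_subset _ _) (fun _ _ _ => by positivity)
    _ ≤ ∑ p ∈ Icc 1 N, (N : ℝ) := by
        refine sum_le_sum (fun p hp => ?_)
        exact_mod_cast (mem_Icc.1 hp).2
    _ = N ^ 2 := by simp; ring

lemma pi_bound : ∃ C : ℝ, 0 < C ∧ ∀ N : ℕ, 2 ≤ N →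
    ((#{p ∈ Icc 1 N | p.Prime} : ℕ) : ℝ) ≤ C * (N / Real.log N) := by
  refine ⟨2 * Real.log 4 + 2, by positivity, fun N hN => ?_⟩
  have hNr : (2 : ℝ) ≤ N := by exact_mod_cast hN
  have hL : 0 < Real.log N := Real.log_pos (by linarith)
  have h := Chebyshev.pi_le_log4_mul_div (show (1 : ℝ) < N by linarith)
  rw [Nat.floor_natCast] at h
  have e : #{p ∈ Icc 1 N | p.Prime} = Nat.primeCounting N := by
    rw [Nat.primeCounting, Nat.primeCounting', Nat.count_eq_card_filter_range]
    congr 1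
    ext p
    simp only [mem_filter, mem_Icc, mem_range]
    constructor
    · rintro ⟨h1, h2⟩; exact ⟨by omega, h2⟩
    · rintro ⟨h1, h2⟩; exact ⟨⟨h2.one_lt.le, by omega⟩, h2⟩
  rw [e]
  refine h.trans ?_
  rw [Real.log_sqrt (by linarith)]
  have : √N ≤ 2 * (N / Real.log N) := by
    rw [← mul_div_assoc, le_div_iff₀ hL]
    have h1 := log_le_two_sqrt (show (0 : ℝ) < N by linarith)
    have h2 := Real.mul_self_sqrt (show (0 : ℝ) ≤ N by linarith)
    nlinarith [Real.sqrt_nonneg (N : ℝ)]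
  have e2 : Real.log 4 * N / (Real.log N / 2) = 2 * Real.log 4 * (N / Real.log N) := by
    field_simp
  rw [e2]; linarith

lemma PP_log_bound : ∃ C : ℝ, 0 < C ∧ ∀ N : ℕ, 2 ≤ N →
    |PP N * Real.log N - N ^ 2 / 2| ≤ C * (N ^ 2 / Real.log N) := by
  obtain ⟨C1, h1, hW⟩ := W_bound
  obtain ⟨C2, h2, hpi⟩ := pi_bound
  refine ⟨C1 + C2, by positivity, fun N hN => ?_⟩
  have hNr : (2 : ℝ) ≤ N := by exact_mod_cast hN
  have hL : 0 < Real.log N := Real.log_pos (by linarith)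
  have e : PP N * Real.log N = W N +
      ∑ p ∈ Icc 1 N with p.Prime, (p : ℝ) * (Real.log N - Real.log p) := by
    unfold PP W
    rw [sum_mul, ← sum_add_distrib]
    exact sum_congr rfl (fun p _ => by ring)
  have b0 : ∀ p ∈ (Icc 1 N).filter Nat.Prime, 0 ≤ (p : ℝ) * (Real.log N - Real.log p) ∧
      (p : ℝ) * (Real.log N - Real.log p) ≤ N := by
    intro p hp
    rw [mem_filter, mem_Icc] at hp
    have p1 : (1 : ℝ) ≤ p := by exact_mod_cast hp.1.1
    have p2 : (p : ℝ) ≤ N := by exact_mod_cast hp.1.2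
    have l := Real.log_le_log (by linarith) p2
    refine ⟨mul_nonneg (by linarith) (by linarith), ?_⟩
    have h1 := Real.log_le_sub_one_of_pos (show (0 : ℝ) < N / p by positivity)
    rw [Real.log_div (by linarith) (by linarith)] at h1
    calc (p : ℝ) * (Real.log N - Real.log p) ≤ p * (N / p) := by gcongr; linarith
      _ = N := by field_simp
  have b1 : 0 ≤ ∑ p ∈ Icc 1 N with p.Prime, (p : ℝ) * (Real.log N - Real.log p) :=
    sum_nonneg (fun p hp => (b0 p hp).1)
  have b2 : ∑ p ∈ Icc 1 N with p.Prime, (p : ℝ) * (Real.log N - Real.log p) ≤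
      C2 * (N ^ 2 / Real.log N) := by
    calc _ ≤ ∑ p ∈ Icc 1 N with p.Prime, (N : ℝ) := sum_le_sum (fun p hp => (b0 p hp).2)
      _ = (#{p ∈ Icc 1 N | p.Prime} : ℕ) * (N : ℝ) := by rw [sum_const, nsmul_eq_mul]
      _ ≤ C2 * (N / Real.log N) * N := by gcongr; exact hpi N hN
      _ = _ := by ring
  have b3 := abs_le.1 (hW N hN)
  have b4 : 0 ≤ C2 * (N ^ 2 / Real.log N) := by positivity
  rw [e, abs_le, add_mul]
  constructor <;> linarith

lemma PP_real : ∃ C : ℝ, 0 < C ∧ ∀ y : ℝ, 2 ≤ y →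
    |PP ⌊y⌋₊ - y ^ 2 / (2 * Real.log y)| ≤ C * (y ^ 2 / Real.log y ^ 2) := by
  obtain ⟨C, hC, hP⟩ := PP_log_bound
  refine ⟨2 * C + 2, by positivity, fun y hy => ?_⟩
  set N := ⌊y⌋₊ with hN
  have hy0 : 0 ≤ y := by linarith
  have hN2 : 2 ≤ N := Nat.le_floor (by exact_mod_cast hy)
  have hNr : (2 : ℝ) ≤ N := by exact_mod_cast hN2
  have hNy : (N : ℝ) ≤ y := Nat.floor_le hy0
  have hyN : y < N + 1 := Nat.lt_floor_add_one y
  have hLN : 0 < Real.log N := Real.log_pos (by linarith)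
  have hL1 : Real.log N ≤ Real.log y := Real.log_le_log (by linarith) hNy
  have hL : 0 < Real.log y := by linarith
  have hL2 : Real.log y ≤ 2 * Real.log N := by
    rw [← Real.log_rpow (by linarith)]
    refine Real.log_le_log (by linarith) ?_
    rw [Real.rpow_two]; nlinarith
  have hLy : Real.log y ≤ y := by
    linarith [Real.log_le_sub_one_of_pos (show (0 : ℝ) < y by linarith)]
  have b1 := hP N hN2
  have b2 : (N : ℝ) ^ 2 / Real.log N ≤ 2 * (y ^ 2 / Real.log y) := by
    rw [← mul_div_assoc, div_le_div_iff₀ hLN hL]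
    have : (N : ℝ) ^ 2 ≤ y ^ 2 := by gcongr
    calc (N : ℝ) ^ 2 * Real.log y ≤ y ^ 2 * (2 * Real.log N) := by gcongr
      _ = _ := by ring
  have b3 : y ≤ y ^ 2 / Real.log y := by
    rw [le_div_iff₀ hL]; nlinarith
  have b4 : PP N * (Real.log y - Real.log N) ≤ N := by
    have h1 := Real.log_le_sub_one_of_pos (show (0 : ℝ) < y / N by positivity)
    rw [Real.log_div (by linarith) (by linarith)] at h1
    have h2 : y / N - 1 ≤ 1 / N := by
      rw [div_sub_one (by linarith)]; gcongr; linarith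
    calc PP N * (Real.log y - Real.log N) ≤ N ^ 2 * (1 / N) := by
          apply mul_le_mul (PP_le N) (by linarith) (by linarith) (by positivity)
      _ = N := by field_simp
  have b5 : 0 ≤ PP N * (Real.log y - Real.log N) := mul_nonneg (PP_nonneg N) (by linarith)
  have b6 : C * ((N : ℝ) ^ 2 / Real.log N) ≤ C * (2 * (y ^ 2 / Real.log y)) := by gcongr
  have b1 := abs_le.1 b1
  have main : |PP N * Real.log y - y ^ 2 / 2| ≤ (2 * C + 2) * (y ^ 2 / Real.log y) := by
    rw [abs_le]
    constructor <;> nlinarith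
  have e1 : PP N - y ^ 2 / (2 * Real.log y) = (PP N * Real.log y - y ^ 2 / 2) / Real.log y := by
    field_simp
  rw [e1, abs_div, abs_of_pos hL, div_le_iff₀ hL]
  refine main.trans (le_of_eq ?_)
  field_simp

end LcmSum


namespace LcmSum
open Finset

lemma log_sq_le {d : ℕ} (hd : 1 ≤ d) {x : ℝ} (hx : 1 ≤ x) (h : x ≤ (d : ℝ) ^ 2) :
    Real.log x ^ 2 ≤ 64 * √d := by
  have hd' : (1 : ℝ) ≤ d := by exact_mod_cast hd
  have h1 : Real.log x ≤ 2 * Real.log d := by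
    have := Real.log_le_log (by linarith) h
    rwa [Real.log_pow] at this
  have h2 : Real.log d = 2 * Real.log √d := by rw [Real.log_sqrt (by linarith)]; ring
  have h3 := log_le_two_sqrt (show (0 : ℝ) < √d from Real.sqrt_pos.2 (by linarith))
  have h4 := Real.mul_self_sqrt (Real.sqrt_nonneg (d : ℝ))
  have h5 := Real.log_nonneg hx
  have h6 : Real.log x ≤ 8 * √√d := by linarith
  calc Real.log x ^ 2 ≤ (8 * √√d) ^ 2 := by gcongr
    _ = 64 * (√√d * √√d) := by ring
    _ = _ := by rw [h4]

lemma log_exp_ge {x : ℝ} (hx : 4 ≤ x) : 1 ≤ Real.log x := by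
  rw [Real.le_log_iff_exp_le (by linarith)]
  linarith [Real.exp_one_lt_d9]

lemma term_bound : ∃ C : ℝ, 0 < C ∧ ∀ x : ℝ, 4 ≤ x → ∀ d : ℕ,
    |PP ⌊x / d⌋₊ - (x / d) ^ 2 / (2 * Real.log x)| ≤
      C * (x ^ 2 / Real.log x ^ 2) * (√d / d ^ 2) := by
  obtain ⟨C, hC, hP⟩ := PP_real
  refine ⟨4 * C + 128, by positivity, fun x hx d => ?_⟩
  rcases Nat.eq_zero_or_pos d with rfl | hd
  · simp [PP]
  have hd' : (1 : ℝ) ≤ d := by exact_mod_cast hd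
  have hL : 1 ≤ Real.log x := log_exp_ge hx
  set L := Real.log x with hLd
  have hsd : 1 ≤ √d := Real.one_le_sqrt.2 hd'
  have hy0 : 0 < x / d := by positivity
  have ey : x ^ 2 / L ^ 2 * (√d / d ^ 2) = (x / d) ^ 2 * (√d / L ^ 2) := by field_simp
  rw [mul_assoc, ey]
  rcases le_or_gt ((d : ℝ) ^ 2) x with h | h
  · have hdx : (d : ℝ) ≤ x / d := by rw [le_div_iff₀ (by linarith)]; nlinarith
    have hy2 : x ≤ (x / d) ^ 2 := by
      rw [div_pow, le_div_iff₀ (by positivity)]; nlinarith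
    have hyge : 2 ≤ x / d := by nlinarith
    have b1 := hP (x / d) hyge
    set y := x / d with hy
    have hlog : L = Real.log y + Real.log d := by
      rw [hy, Real.log_div (by linarith) (by linarith)]; ring
    have hl2 : L ≤ 2 * Real.log y := by
      have := Real.log_le_log (by linarith) hy2
      rwa [Real.log_pow] at this
    have hld := Real.log_nonneg hd'
    have hld2 := log_le_two_sqrt (show (0 : ℝ) < d by linarith)
    have hly : 0 < Real.log y := by linarith
    have c1 : y ^ 2 / Real.log y ^ 2 ≤ 4 * (y ^ 2 * (√d / L ^ 2)) := by
      have : L ^ 2 ≤ 4 * Real.log y ^ 2 := by nlinarith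
      rw [← mul_div_assoc, ← mul_div_assoc, div_le_div_iff₀ (by positivity) (by positivity)]
      have h3 : 4 * Real.log y ^ 2 ≤ 4 * Real.log y ^ 2 * √d := by
        nlinarith [sq_nonneg (Real.log y)]
      calc y ^ 2 * L ^ 2 ≤ y ^ 2 * (4 * Real.log y ^ 2 * √d) := by gcongr; linarith
        _ = _ := by ring
    have c2 : |y ^ 2 / (2 * Real.log y) - y ^ 2 / (2 * L)| ≤ 2 * (y ^ 2 * (√d / L ^ 2)) := by
      have e : y ^ 2 / (2 * Real.log y) - y ^ 2 / (2 * L) =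
          y ^ 2 * (Real.log d / (2 * Real.log y * L)) := by
        rw [div_sub_div _ _ (by positivity) (by positivity), hlog]
        have : Real.log y + Real.log d ≠ 0 := by linarith
        field_simp
        ring
      rw [e, abs_of_nonneg (by positivity)]
      have : Real.log d / (2 * Real.log y * L) ≤ 2 * √d / (L * L) := by
        gcongr
      calc _ ≤ y ^ 2 * (2 * √d / (L * L)) := by gcongr
        _ = _ := by ring
    have c3 : 0 ≤ y ^ 2 * (√d / L ^ 2) := by positivity
    have c4 := mul_le_mul_of_nonneg_left c1 hC.le
    have := abs_add_le (PP ⌊y⌋₊ - y ^ 2 / (2 * Real.log y)) (y ^ 2 / (2 * Real.log y) - y ^ 2 / (2 * L))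
    rw [sub_add_sub_cancel] at this
    nlinarith
  · have b1 : 1 ≤ 64 * (√d / L ^ 2) := by
      rw [← mul_div_assoc, one_le_div (by positivity)]
      exact log_sq_le hd (by linarith) h.le
    set y := x / d with hy
    have b2 : PP ⌊y⌋₊ ≤ y ^ 2 := by
      refine (PP_le _).trans ?_
      have := Nat.floor_le hy0.le
      gcongr
    have b3 : y ^ 2 / (2 * L) ≤ y ^ 2 := by
      rw [div_le_iff₀ (by positivity)]; nlinarith [sq_nonneg y]
    have b4 : 0 ≤ y ^ 2 / (2 * L) := by positivity
    have b5 := PP_nonneg ⌊y⌋₊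
    have b6 : |PP ⌊y⌋₊ - y ^ 2 / (2 * L)| ≤ y ^ 2 := by
      rw [abs_le]; constructor <;> linarith
    have b7 : y ^ 2 ≤ 64 * (y ^ 2 * (√d / L ^ 2)) := by nlinarith [sq_nonneg y]
    have b8 : 0 ≤ y ^ 2 * (√d / L ^ 2) := by positivity
    nlinarith

noncomputable def Q (N : ℕ) : ℝ := ∑ p ∈ Icc 1 N with p.Prime, (p : ℝ) * ((N / p : ℕ) : ℝ)

lemma Q_eq (N : ℕ) : Q N = ∑ d ∈ Icc 1 N, PP (N / d) := by
  have h : ∀ p ∈ (Icc 1 N).filter Nat.Prime, (p : ℝ) * ((N / p : ℕ) : ℝ) =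
      ∑ d ∈ Icc 1 N, if p * d ≤ N then (p : ℝ) else 0 := by
    intro p hp
    rw [mem_filter, mem_Icc] at hp
    rw [← sum_filter, sum_const, nsmul_eq_mul, mul_comm]
    congr 2
    have : (Icc 1 N).filter (fun d => p * d ≤ N) = Icc 1 (N / p) := by
      ext d
      simp only [mem_filter, mem_Icc]
      rw [Nat.le_div_iff_mul_le (by omega), mul_comm]
      constructor
      · rintro ⟨⟨h1, h2⟩, h3⟩; exact ⟨h1, h3⟩
      · rintro ⟨h1, h3⟩; exact ⟨⟨h1, by nlinarith⟩, h3⟩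
    rw [this]; simp
  unfold Q PP
  rw [sum_congr rfl h, sum_comm]
  refine sum_congr rfl (fun d hd => ?_)
  rw [mem_Icc] at hd
  rw [← sum_filter]
  refine sum_congr ?_ (fun _ _ => rfl)
  ext p
  simp only [mem_filter, mem_Icc]
  rw [Nat.le_div_iff_mul_le (by omega)]
  constructor
  · rintro ⟨⟨⟨h1, h2⟩, h3⟩, h4⟩; exact ⟨⟨h1, h4⟩, h3⟩
  · rintro ⟨⟨h1, h4⟩, h3⟩; exact ⟨⟨⟨h1, by nlinarith⟩, h3⟩, h4⟩

lemma Q_bound : ∃ C : ℝ, 0 < C ∧ ∀ x : ℝ, 4 ≤ x →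
    |Q ⌊x⌋₊ - Real.pi ^ 2 * x ^ 2 / (12 * Real.log x)| ≤ C * (x ^ 2 / Real.log x ^ 2) := by
  obtain ⟨C, hC, hT⟩ := term_bound
  have hs : Summable (fun d : ℕ => √d / (d : ℝ) ^ 2) := by
    have := Real.summable_nat_rpow_inv.2 (show (1 : ℝ) < 3 / 2 by norm_num)
    refine this.congr (fun d => ?_)
    rcases Nat.eq_zero_or_pos d with rfl | hd
    · simp
    · have hd' : (0 : ℝ) < d := by exact_mod_cast hd
      rw [Real.sqrt_eq_rpow, ← Real.rpow_natCast, ← Real.rpow_sub hd', ← Real.rpow_neg hd'.le]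
      norm_num
  set A := ∑' d : ℕ, √d / (d : ℝ) ^ 2 with hA
  have hA0 : 0 ≤ A := tsum_nonneg (fun d => by positivity)
  refine ⟨C * A + 1, by positivity, fun x hx => ?_⟩
  have hL : 1 ≤ Real.log x := log_exp_ge hx
  have h1 : HasSum (fun d : ℕ => PP ⌊x / d⌋₊) (Q ⌊x⌋₊) := by
    rw [Q_eq]
    have : ∑ d ∈ Icc 1 ⌊x⌋₊, PP (⌊x⌋₊ / d) = ∑ d ∈ Icc 1 ⌊x⌋₊, PP ⌊x / d⌋₊ := by
      refine sum_congr rfl (fun d _ => ?_)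
      rw [Nat.floor_div_natCast]
    rw [this]
    refine hasSum_sum_of_ne_finset_zero (fun d hd => ?_)
    rw [mem_Icc, not_and_or] at hd
    rcases hd with hd | hd
    · have : d = 0 := by omega
      subst this; simp [PP]
    · rw [Nat.floor_div_natCast, Nat.div_eq_of_lt (by omega)]
      simp [PP]
  have h2 : HasSum (fun d : ℕ => (x / d) ^ 2 / (2 * Real.log x))
      (Real.pi ^ 2 * x ^ 2 / (12 * Real.log x)) := by
    have := hasSum_zeta_two.mul_left (x ^ 2 / (2 * Real.log x))
    have e : x ^ 2 / (2 * Real.log x) * (Real.pi ^ 2 / 6) =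
      Real.pi ^ 2 * x ^ 2 / (12 * Real.log x) := by field_simp; norm_num
    rw [e] at this
    refine this.congr_fun ?_
    intro d
    rw [div_pow]; ring
  have h3 := h1.sub h2
  have h4 := (hs.hasSum).mul_left (C * (x ^ 2 / Real.log x ^ 2))
  have h5 := tsum_of_norm_bounded h4 (fun d => by
    rw [Real.norm_eq_abs]; exact hT x hx d)
  rw [h3.tsum_eq, Real.norm_eq_abs] at h5
  refine h5.trans ?_
  have : 0 ≤ x ^ 2 / Real.log x ^ 2 := by positivity
  rw [← hA]
  nlinarith

end LcmSum


namespace LcmSum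
open Finset

lemma f_prod (f : ℕ → ℂ) (hadd : ∀ m n : ℕ, Nat.Coprime m n → f (m * n) = f m + f n)
    (s : Finset ℕ) (hs : ∀ p ∈ s, p.Prime) (e : ℕ → ℕ) :
    f (∏ p ∈ s, p ^ e p) = ∑ p ∈ s, f (p ^ e p) := by
  have f1 : f 1 = 0 := by
    have := hadd 1 1 (by simp)
    simpa using this
  induction s using Finset.induction_on with
  | empty => simp [f1]
  | insert q s hq ih =>
    rw [prod_insert hq, sum_insert hq, hadd, ih (fun p hp => hs p (mem_insert_of_mem hp))]
    refine Nat.Coprime.prod_right (fun p hp => ?_)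
    refine Nat.coprime_pow_primes _ _ (hs q (mem_insert_self _ _)) (hs p (mem_insert_of_mem hp)) ?_
    rintro rfl; exact hq hp

lemma f_fac (f : ℕ → ℂ) (hadd : ∀ m n : ℕ, Nat.Coprime m n → f (m * n) = f m + f n)
    {m : ℕ} (hm : m ≠ 0) : f m = ∑ p ∈ m.primeFactors, f (p ^ m.factorization p) := by
  rw [← f_prod f hadd _ (fun p hp => Nat.prime_of_mem_primeFactors hp)]
  congr 1
  exact (Nat.prod_factorization_pow_eq_self hm).symm

noncomputable def G (l n : ℕ) : ℝ :=
  ∑ p ∈ n.primeFactors with 2 ≤ n.factorization p,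
    (n.factorization p : ℝ) ^ l * (p : ℝ) ^ (n.factorization p)

lemma G_nonneg (l n : ℕ) : 0 ≤ G l n := sum_nonneg (fun p _ => by positivity)

lemma lcm_fac {k : ℕ} (n : Fin k → ℕ) (hn : ∀ i, n i ≠ 0) {p : ℕ} (hp : p.Prime) {v : ℕ}
    (hv : (univ.lcm n).factorization p = v) (hv1 : 1 ≤ v) :
    ∃ i, (n i).factorization p = v := by
  have hm : univ.lcm n ≠ 0 := by
    rw [Ne, Finset.lcm_eq_zero_iff]; simp [hn]
  have hdiv : ∀ i, (n i).factorization p ≤ v := by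
    intro i
    rw [← hv]
    exact (Nat.factorization_le_iff_dvd (hn i) hm).2 (dvd_lcm (mem_univ i)) p
  by_contra hcon
  push Not at hcon
  have hlt : ∀ i, (n i).factorization p ≤ v - 1 := fun i => by
    have := hdiv i; have := hcon i; omega
  have hpv : p ^ v ∣ univ.lcm n := by rw [← hv]; exact Nat.ordProj_dvd _ _
  -- lcm divides (lcm / p)
  obtain ⟨q, hq⟩ : p ∣ univ.lcm n := (dvd_pow_self p (by omega)).trans hpv
  have hq0 : q ≠ 0 := by rintro rfl; simp at hq; exact hm (by simpa using hq)
  have hall : univ.lcm n ∣ q := by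
    refine Finset.lcm_dvd (fun i _ => ?_)
    rw [← Nat.factorization_le_iff_dvd (hn i) hq0]
    intro r
    have hr := (Nat.factorization_le_iff_dvd (hn i) hm).2 (dvd_lcm (mem_univ i)) r
    rw [hq, Nat.factorization_mul hp.ne_zero hq0] at hr
    by_cases hrp : r = p
    · subst hrp
      have h1 := hlt i
      rw [hq, Nat.factorization_mul hp.ne_zero hq0] at hv
      simp only [Finsupp.coe_add, Pi.add_apply, hp.factorization_self] at hv
      omega
    · simp only [Finsupp.coe_add, Pi.add_apply, hp.factorization] at hr
      rw [Finsupp.single_apply, if_neg (fun h => hrp h.symm)] at hr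
      omega
  have h1 := Nat.le_of_dvd (Nat.pos_of_ne_zero hq0) hall
  have h2 := hp.two_le
  have h3 : 0 < q := Nat.pos_of_ne_zero hq0
  nlinarith

lemma f_err (f : ℕ → ℂ) (hadd : ∀ m n : ℕ, Nat.Coprime m n → f (m * n) = f m + f n)
    (hp1 : ∀ p : ℕ, p.Prime → f p = (p : ℂ)) (l : ℕ) (K : ℝ)
    (hb : ∀ p : ℕ, p.Prime → ∀ ν : ℕ, 2 ≤ ν → ‖f (p ^ ν)‖ ≤ K * (ν : ℝ) ^ l * (p : ℝ) ^ ν)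
    {k : ℕ} (n : Fin k → ℕ) (hn : ∀ i, n i ≠ 0) :
    ‖f (univ.lcm n) - ∑ p ∈ (univ.lcm n).primeFactors, (p : ℂ)‖ ≤
      (|K| + 1) * ∑ i, G l (n i) := by
  have hm : univ.lcm n ≠ 0 := by
    rw [Ne, Finset.lcm_eq_zero_iff]; simp [hn]
  set m := univ.lcm n with hmd
  rw [f_fac f hadd hm, ← sum_sub_distrib]
  refine (norm_sum_le _ _).trans ?_
  have key : ∀ p ∈ m.primeFactors, ‖f (p ^ m.factorization p) - p‖ ≤
      ∑ i, if p ∈ (n i).primeFactors ∧ 2 ≤ (n i).factorization p then (|K| + 1) *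
        (((n i).factorization p : ℝ) ^ l * (p : ℝ) ^ ((n i).factorization p)) else 0 := by
    intro p hp
    have hpp := Nat.prime_of_mem_primeFactors hp
    have hp2 : (1 : ℝ) ≤ p := by exact_mod_cast hpp.one_lt.le
    have hv1 : 1 ≤ m.factorization p :=
      hpp.factorization_pos_of_dvd hm (Nat.dvd_of_mem_primeFactors hp)
    rcases Nat.lt_or_ge (m.factorization p) 2 with h | h
    · have : m.factorization p = 1 := by omega
      rw [this, pow_one, hp1 p hpp, sub_self, norm_zero]
      exact sum_nonneg (fun i _ => by split_ifs <;> positivity)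
    · obtain ⟨i, hi⟩ := lcm_fac n hn hpp (rfl) hv1
      rw [← hmd] at hi
      refine le_trans ?_ (single_le_sum (fun i _ => by split_ifs <;> positivity) (mem_univ i))
      have hmem : p ∈ (n i).primeFactors := by
        rw [Nat.mem_primeFactors]
        refine ⟨hpp, ?_, hn i⟩
        by_contra hd
        rw [Nat.factorization_eq_zero_of_not_dvd hd] at hi
        omega
      rw [if_pos ⟨hmem, by rw [hi]; exact h⟩, hi]
      · refine (norm_sub_le _ _).trans ?_
        have h1 := hb p hpp _ h
        rw [Complex.norm_natCast]
        have h2 : (p : ℝ) ≤ (p : ℝ) ^ m.factorization p := le_self_pow₀ hp2 (by omega)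
        have h3 : (1 : ℝ) ≤ (m.factorization p : ℝ) ^ l := one_le_pow₀ (by exact_mod_cast hv1)
        have h4 : (p : ℝ) ≤ (m.factorization p : ℝ) ^ l * (p : ℝ) ^ m.factorization p := by nlinarith
        have h5 : K * (m.factorization p : ℝ) ^ l * (p : ℝ) ^ m.factorization p ≤
            |K| * ((m.factorization p : ℝ) ^ l * (p : ℝ) ^ m.factorization p) := by
          rw [mul_assoc]; gcongr; exact le_abs_self K
        linarith
  refine (sum_le_sum key).trans ?_
  rw [sum_comm, mul_sum]
  refine sum_le_sum (fun i _ => ?_)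
  unfold G
  rw [sum_filter, mul_sum]
  refine le_trans (le_of_eq ?_) (sum_le_sum_of_subset_of_nonneg (s := m.primeFactors ∩ (n i).primeFactors)
    inter_subset_right (fun p _ _ => by split_ifs <;> positivity))
  rw [← filter_mem_eq_inter, sum_filter]
  refine sum_congr rfl (fun p _ => ?_)
  by_cases h1 : p ∈ (n i).primeFactors <;> by_cases h2 : 2 ≤ (n i).factorization p <;> simp [h1, h2]

lemma card_dvd (N d : ℕ) : #{n ∈ Icc 1 N | d ∣ n} = N / d := Nat.Ioc_filter_dvd_card_eq_div N d

lemma G_sum (l N : ℕ) : ∑ n ∈ Icc 1 N, G l n ≤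
    (Nat.log 2 N : ℝ) ^ (l + 1) * ((Nat.sqrt N : ℝ) * N) := by
  have h1 : ∀ n ∈ Icc 1 N, G l n ≤ ∑ v ∈ Icc 1 (Nat.log 2 N), ∑ p ∈ Icc 1 (Nat.sqrt N),
      if p ^ v ∣ n then (v : ℝ) ^ l * (p : ℝ) ^ v else 0 := by
    intro n hn
    rw [mem_Icc] at hn
    unfold G
    rw [sum_comm]
    have hsub : (n.primeFactors.filter (fun p => 2 ≤ n.factorization p)) ⊆ Icc 1 (Nat.sqrt N) := by
      intro p hp
      rw [mem_filter] at hp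
      have hpp := Nat.prime_of_mem_primeFactors hp.1
      rw [mem_Icc, Nat.le_sqrt']
      refine ⟨hpp.one_lt.le, ?_⟩
      have hd : p ^ 2 ∣ n := (pow_dvd_pow p hp.2).trans (Nat.ordProj_dvd n p)
      exact (Nat.le_of_dvd (by omega) hd).trans hn.2
    refine le_trans ?_ (sum_le_sum_of_subset_of_nonneg hsub
      (fun p _ _ => sum_nonneg (fun v _ => by split_ifs <;> positivity)))
    refine sum_le_sum (fun p hp => ?_)
    rw [mem_filter] at hp
    have hpp := Nat.prime_of_mem_primeFactors hp.1
    have hd : p ^ n.factorization p ∣ n := Nat.ordProj_dvd n p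
    have hmem : n.factorization p ∈ Icc 1 (Nat.log 2 N) := by
      rw [mem_Icc]
      refine ⟨by omega, Nat.le_log_of_pow_le (by norm_num) ?_⟩
      calc 2 ^ n.factorization p ≤ p ^ n.factorization p := Nat.pow_le_pow_left hpp.two_le _
        _ ≤ n := Nat.le_of_dvd (by omega) hd
        _ ≤ N := hn.2
    refine le_trans ?_ (single_le_sum (fun v _ => by split_ifs <;> positivity) hmem)
    rw [if_pos hd]
  refine (sum_le_sum h1).trans ?_
  rw [sum_comm]
  have h2 : ∀ v ∈ Icc 1 (Nat.log 2 N), ∑ n ∈ Icc 1 N, ∑ p ∈ Icc 1 (Nat.sqrt N),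
      (if p ^ v ∣ n then (v : ℝ) ^ l * (p : ℝ) ^ v else 0) ≤
      (Nat.log 2 N : ℝ) ^ l * ((Nat.sqrt N : ℝ) * N) := by
    intro v hv
    rw [mem_Icc] at hv
    rw [sum_comm]
    have : ∀ p ∈ Icc 1 (Nat.sqrt N), ∑ n ∈ Icc 1 N,
        (if p ^ v ∣ n then (v : ℝ) ^ l * (p : ℝ) ^ v else 0) ≤ (Nat.log 2 N : ℝ) ^ l * N := by
      intro p hp
      rw [← sum_filter, sum_const, card_dvd, nsmul_eq_mul]
      have a1 : ((N / p ^ v : ℕ) : ℝ) * (p : ℝ) ^ v ≤ N := by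
        exact_mod_cast Nat.div_mul_le_self N (p ^ v)
      have a2 : (v : ℝ) ≤ (Nat.log 2 N : ℝ) := by exact_mod_cast hv.2
      calc _ = (v : ℝ) ^ l * (((N / p ^ v : ℕ) : ℝ) * (p : ℝ) ^ v) := by ring
        _ ≤ _ := by gcongr
    refine (sum_le_sum this).trans (le_of_eq ?_)
    simp; ring
  refine (sum_le_sum h2).trans (le_of_eq ?_)
  simp; ring

lemma bern (k : ℕ) {r : ℝ} (h0 : 0 ≤ r) (h1 : r ≤ 1) :
    |1 - (1 - r) ^ k - k * r| ≤ (k : ℝ) ^ 2 * r ^ 2 := by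
  have a : 1 + (k : ℝ) * (-r) ≤ (1 + (-r)) ^ k := one_add_mul_le_pow (by linarith) k
  have b : (1 - r) ^ k ≤ 1 - k * r + (k : ℝ) ^ 2 * r ^ 2 := by
    clear a
    induction k with
    | zero => simp
    | succ k ih =>
      rw [pow_succ]
      have := mul_le_mul_of_nonneg_right ih (show 0 ≤ 1 - r by linarith)
      push_cast
      have h3 : 0 ≤ (k : ℝ) ^ 2 * (r ^ 2 * r) := by positivity
      have h4 : 0 ≤ (k : ℝ) * r ^ 2 := by positivity
      nlinarith
  rw [← sub_eq_add_neg] at a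
  rw [abs_le]
  constructor <;> nlinarith [sq_nonneg ((k : ℝ) * r)]

lemma main_eq (k N : ℕ) :
    ∑ n ∈ Fintype.piFinset (fun _ : Fin k => Icc 1 N), ∑ p ∈ (univ.lcm n).primeFactors, (p : ℝ) =
    ∑ p ∈ Icc 1 N with p.Prime, (p : ℝ) * ((N : ℝ) ^ k - ((N : ℝ) - (N / p : ℕ)) ^ k) := by
  have hdv : ∀ (n : Fin k → ℕ) (p : ℕ), p.Prime → (p ∣ univ.lcm n ↔ ∃ i, p ∣ n i) := by
    intro n p hp
    constructor
    · intro h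
      have : univ.lcm n ∣ ∏ i, n i := Finset.lcm_dvd (fun i hi => dvd_prod_of_mem n hi)
      obtain ⟨i, _, hi⟩ := (hp.prime.dvd_finsetProd_iff n).1 (h.trans this)
      exact ⟨i, hi⟩
    · rintro ⟨i, hi⟩; exact hi.trans (dvd_lcm (mem_univ i))
  have e1 : ∀ n ∈ Fintype.piFinset (fun _ : Fin k => Icc 1 N),
      ∑ p ∈ (univ.lcm n).primeFactors, (p : ℝ) =
      ∑ p ∈ Icc 1 N with p.Prime, if ∃ i, p ∣ n i then (p : ℝ) else 0 := by
    intro n hn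
    rw [Fintype.mem_piFinset] at hn
    rw [← sum_filter]
    refine sum_congr ?_ (fun _ _ => rfl)
    ext p
    simp only [Nat.mem_primeFactors, mem_filter, mem_Icc]
    have hm : univ.lcm n ≠ 0 := by
      rw [Ne, Finset.lcm_eq_zero_iff]
      simp only [mem_univ, true_and, not_exists]
      intro i hi
      have := mem_Icc.1 (hn i)
      omega
    constructor
    · rintro ⟨hp, hd, _⟩
      obtain ⟨i, hi⟩ := (hdv n p hp).1 hd
      have := mem_Icc.1 (hn i)
      exact ⟨⟨⟨hp.one_lt.le, (Nat.le_of_dvd (by omega) hi).trans this.2⟩, hp⟩, i, hi⟩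
    · rintro ⟨⟨_, hp⟩, h⟩
      exact ⟨hp, (hdv n p hp).2 h, hm⟩
  rw [sum_congr rfl e1, sum_comm]
  refine sum_congr rfl (fun p hp => ?_)
  have e2 : ∑ n ∈ Fintype.piFinset (fun _ : Fin k => Icc 1 N),
      (if ∃ i, p ∣ n i then (p : ℝ) else 0) =
      ∑ n ∈ Fintype.piFinset (fun _ : Fin k => Icc 1 N), (p : ℝ) -
      ∑ n ∈ Fintype.piFinset (fun _ : Fin k => Icc 1 N), (if ∀ i, ¬ p ∣ n i then (p : ℝ) else 0) := by
    rw [← sum_sub_distrib]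
    refine sum_congr rfl (fun n _ => ?_)
    by_cases h : ∃ i, p ∣ n i
    · rw [if_pos h, if_neg (by push Not; exact h)]; ring
    · rw [if_neg h, if_pos (by push Not at h; exact h)]; ring
  have e3 : (Fintype.piFinset (fun _ : Fin k => Icc 1 N)).filter (fun n => ∀ i, ¬ p ∣ n i) =
      Fintype.piFinset (fun _ : Fin k => (Icc 1 N).filter (fun m => ¬ p ∣ m)) := by
    ext n
    simp only [mem_filter, Fintype.mem_piFinset]
    exact ⟨fun h i => ⟨h.1 i, h.2 i⟩, fun h => ⟨fun i => (h i).1, fun i => (h i).2⟩⟩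
  have e4 : ((#((Icc 1 N).filter (fun m => ¬ p ∣ m)) : ℕ) : ℝ) = (N : ℝ) - (N / p : ℕ) := by
    have := card_filter_add_card_filter_not (s := Icc 1 N) (fun m => p ∣ m)
    rw [card_dvd, Nat.card_Icc] at this
    have h2 : ((N / p : ℕ) : ℝ) + ((#((Icc 1 N).filter (fun m => ¬ p ∣ m)) : ℕ) : ℝ) = N := by
      exact_mod_cast this
    linarith
  rw [e2, ← sum_filter, e3, sum_const, sum_const, Fintype.card_piFinset_const,
    Fintype.card_piFinset_const, nsmul_eq_mul, nsmul_eq_mul]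
  push_cast
  rw [e4]
  simp
  ring

lemma main_bound (j N : ℕ) (hN : 1 ≤ N) :
    |∑ n ∈ Fintype.piFinset (fun _ : Fin (j + 1) => Icc 1 N),
      ∑ p ∈ (univ.lcm n).primeFactors, (p : ℝ) - (j + 1 : ℕ) * (N : ℝ) ^ j * Q N| ≤
    ((j + 1 : ℕ) : ℝ) ^ 2 * (N : ℝ) ^ (j + 1) * (1 + Real.log N) := by
  have hNr : (1 : ℝ) ≤ N := by exact_mod_cast hN
  rw [main_eq, Q, mul_sum, ← sum_sub_distrib]
  refine (abs_sum_le_sum_abs _ _).trans ?_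
  have h1 : ∀ p ∈ (Icc 1 N).filter Nat.Prime,
      |(p : ℝ) * ((N : ℝ) ^ (j + 1) - ((N : ℝ) - (N / p : ℕ)) ^ (j + 1)) -
        (j + 1 : ℕ) * (N : ℝ) ^ j * ((p : ℝ) * (N / p : ℕ))| ≤
      ((j + 1 : ℕ) : ℝ) ^ 2 * (N : ℝ) ^ (j + 1) * (p : ℝ)⁻¹ := by
    intro p hp
    rw [mem_filter, mem_Icc] at hp
    have hp1 : (1 : ℝ) ≤ p := by exact_mod_cast hp.1.1
    have hb : ((N / p : ℕ) : ℝ) ≤ N / p := Nat.cast_div_le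
    set r : ℝ := ((N / p : ℕ) : ℝ) / N with hr
    have hr0 : 0 ≤ r := by positivity
    have hrp : r ≤ (p : ℝ)⁻¹ := by
      rw [hr, div_le_iff₀ (by linarith)]
      refine hb.trans (le_of_eq ?_); ring
    have hr1 : r ≤ 1 := hrp.trans (inv_le_one_of_one_le₀ hp1)
    have hbr : ((N / p : ℕ) : ℝ) = N * r := by rw [hr]; field_simp
    have e : (p : ℝ) * ((N : ℝ) ^ (j + 1) - ((N : ℝ) - (N / p : ℕ)) ^ (j + 1)) -
        (j + 1 : ℕ) * (N : ℝ) ^ j * ((p : ℝ) * (N / p : ℕ)) =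
        p * (N : ℝ) ^ (j + 1) * (1 - (1 - r) ^ (j + 1) - (j + 1 : ℕ) * r) := by
      rw [hbr]
      have : (N : ℝ) - N * r = N * (1 - r) := by ring
      rw [this, mul_pow]; ring
    rw [e, abs_mul, abs_of_nonneg (by positivity)]
    calc _ ≤ p * (N : ℝ) ^ (j + 1) * (((j + 1 : ℕ) : ℝ) ^ 2 * r ^ 2) := by
          gcongr; exact bern (j + 1) hr0 hr1
      _ ≤ p * (N : ℝ) ^ (j + 1) * (((j + 1 : ℕ) : ℝ) ^ 2 * (p : ℝ)⁻¹ ^ 2) := by gcongr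
      _ = _ := by field_simp
  refine (sum_le_sum h1).trans ?_
  rw [← mul_sum]
  gcongr
  have h2 := harmonic_le_one_add_log N
  rw [harmonic_eq_sum_Icc] at h2
  push_cast at h2
  refine le_trans ?_ h2
  exact sum_le_sum_of_subset_of_nonneg (filter_subset _ _) (fun _ _ _ => by positivity)

lemma Q_le (N : ℕ) : Q N ≤ (N : ℝ) ^ 2 := by
  unfold Q
  calc _ ≤ ∑ p ∈ Icc 1 N with p.Prime, (N : ℝ) := by
        refine sum_le_sum (fun p hp => ?_)
        exact_mod_cast Nat.mul_div_le N p
    _ ≤ ∑ p ∈ Icc 1 N, (N : ℝ) :=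
        sum_le_sum_of_subset_of_nonneg (filter_subset _ _) (fun _ _ _ => by positivity)
    _ = _ := by simp; ring

lemma Q_nonneg (N : ℕ) : 0 ≤ Q N := sum_nonneg (fun p _ => by positivity)

end LcmSum


namespace LcmSum

theorem lcm_main (f : ℕ → ℂ)
    (hadd : ∀ m n : ℕ, Nat.Coprime m n → f (m * n) = f m + f n)
    (hp1 : ∀ p : ℕ, p.Prime → f p = (p : ℂ))
    (hbound : ∃ (l : ℕ) (K : ℝ), ∀ p : ℕ, p.Prime → ∀ ν : ℕ, 2 ≤ ν →
      ‖f (p ^ ν)‖ ≤ K * (ν : ℝ) ^ l * (p : ℝ) ^ ν)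
    (k : ℕ) (hk : 1 ≤ k) :
    ∃ c > (0 : ℝ), ∃ x₀ : ℝ, 3 ≤ x₀ ∧ ∀ x ≥ x₀,
      ‖(∑ n ∈ Fintype.piFinset (fun _ : Fin k => Finset.Icc 1 ⌊x⌋₊),
          f (Finset.univ.lcm n)) -
          ((Real.pi ^ 2 * k * x ^ (k + 1) / (12 * Real.log x) : ℝ) : ℂ)‖ ≤
        c * x ^ (k + 1) / (Real.log x) ^ 2 := by
  obtain ⟨l, K, hb⟩ := hbound
  obtain ⟨C, hC, hQ⟩ := Q_bound
  obtain ⟨j, rfl⟩ : ∃ j, k = j + 1 := ⟨k - 1, by omega⟩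
  have hev : ∀ᶠ x : ℝ in Filter.atTop, Real.log x ^ (2 * (l + 3)) ≤ x := by
    have := (Real.isLittleO_pow_log_id_atTop (n := 2 * (l + 3))).bound (show (0 : ℝ) < 1 by norm_num)
    filter_upwards [this, Filter.eventually_ge_atTop 1] with x h1 h2
    rw [one_mul, id, Real.norm_eq_abs, Real.norm_eq_abs, abs_of_nonneg (show 0 ≤ x by linarith)] at h1
    exact (le_abs_self _).trans h1
  obtain ⟨x₁, hx₁⟩ := Filter.eventually_atTop.1 hev
  set k' : ℝ := ((j + 1 : ℕ) : ℝ) with hk'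
  have hk0 : 0 < k' := by rw [hk']; positivity
  refine ⟨(|K| + 1) * k' * 2 ^ (l + 1) + 3 * k' ^ 2 + k' * C, by positivity, max x₁ 4,
    le_trans (by norm_num) (le_max_right _ _), fun x hx => ?_⟩
  have hx4 : 4 ≤ x := (le_max_right _ _).trans hx
  have hxl := hx₁ x ((le_max_left _ _).trans hx)
  have hL1 : 1 ≤ Real.log x := log_exp_ge hx4
  have hQx := hQ x hx4
  set N := ⌊x⌋₊ with hN
  set L := Real.log x with hL
  have hN1 : 1 ≤ N := Nat.le_floor (by push_cast; linarith)
  have hNx : (N : ℝ) ≤ x := Nat.floor_le (by linarith)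
  have hxN : x < N + 1 := Nat.lt_floor_add_one x
  have hNr : (1 : ℝ) ≤ N := by exact_mod_cast hN1
  have hLN : Real.log N ≤ L := Real.log_le_log (by linarith) hNx
  have hsq : L ^ (l + 3) ≤ √x := by
    apply Real.le_sqrt_of_sq_le
    rw [← pow_mul, mul_comm]; exact hxl
  have hss : √x * √x = x := Real.mul_self_sqrt (by linarith)
  set S := Fintype.piFinset (fun _ : Fin (j + 1) => Finset.Icc 1 N) with hS
  set R := x ^ (j + 1 + 1) / L ^ 2 with hR
  have hR0 : 0 ≤ R := by positivity
  -- error from prime powers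
  have A1 : ‖∑ n ∈ S, f (Finset.univ.lcm n) -
      ((∑ n ∈ S, ∑ p ∈ (Finset.univ.lcm n).primeFactors, (p : ℝ) : ℝ) : ℂ)‖ ≤
      (|K| + 1) * k' * 2 ^ (l + 1) * R := by
    push_cast
    rw [← Finset.sum_sub_distrib]
    refine (norm_sum_le _ _).trans ?_
    have h1 : ∀ n ∈ S, ‖f (Finset.univ.lcm n) -
        ∑ p ∈ (Finset.univ.lcm n).primeFactors, (p : ℂ)‖ ≤ (|K| + 1) * ∑ i, G l (n i) := by
      intro n hn
      refine f_err f hadd hp1 l K hb n (fun i => ?_)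
      have := Finset.mem_Icc.1 (Fintype.mem_piFinset.1 hn i)
      omega
    refine (Finset.sum_le_sum h1).trans ?_
    rw [← Finset.mul_sum, Finset.sum_comm]
    have h2 : ∀ i ∈ (Finset.univ : Finset (Fin (j + 1))), ∑ n ∈ S, G l (n i) ≤
        x ^ j * (2 ^ (l + 1) * (x ^ 2 / L ^ 2)) := by
      intro i _
      rw [hS, Fintype.sum_piFinset_apply (G l) (Finset.Icc 1 N) i, nsmul_eq_mul]
      simp only [Fintype.card_fin, Nat.add_sub_cancel, Nat.card_Icc]
      have g1 := G_sum l N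
      have g2 : ((Nat.log 2 N : ℕ) : ℝ) ≤ 2 * L := by
        have a := Real.natLog_le_logb N 2
        rw [Real.logb] at a
        push_cast at a
        refine a.trans ?_
        have := log2_gt
        rw [div_le_iff₀ (by linarith)]
        nlinarith
      have g3 : ((Nat.sqrt N : ℕ) : ℝ) ≤ √x := by
        refine Real.nat_sqrt_le_real_sqrt.trans ?_
        exact Real.sqrt_le_sqrt hNx
      have g4 : ∑ n ∈ Finset.Icc 1 N, G l n ≤ 2 ^ (l + 1) * (x ^ 2 / L ^ 2) := by
        refine g1.trans ?_
        calc _ ≤ (2 * L) ^ (l + 1) * (√x * x) := by gcongr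
          _ = 2 ^ (l + 1) * ((L ^ (l + 3) * √x * x) / L ^ 2) := by
              field_simp; ring
          _ ≤ 2 ^ (l + 1) * ((√x * √x * x) / L ^ 2) := by gcongr
          _ = _ := by rw [hss]; ring
      push_cast
      gcongr
      exact Finset.sum_nonneg (fun n _ => G_nonneg l n)
    have h3 := Finset.sum_le_sum h2
    rw [Finset.sum_const, Finset.card_univ, Fintype.card_fin, nsmul_eq_mul] at h3
    calc _ ≤ (|K| + 1) * (k' * (x ^ j * (2 ^ (l + 1) * (x ^ 2 / L ^ 2)))) := by gcongr
      _ = _ := by rw [hR]; ring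
  have hL3 : L ^ 3 ≤ x := by
    calc L ^ 3 ≤ L ^ (2 * (l + 3)) := pow_le_pow_right₀ hL1 (by omega)
      _ ≤ x := hxl
  have hxkL : x ^ (j + 1) * L ≤ R := by
    rw [hR, le_div_iff₀ (by positivity)]
    calc x ^ (j + 1) * L * L ^ 2 = x ^ (j + 1) * L ^ 3 := by ring
      _ ≤ x ^ (j + 1) * x := by gcongr
      _ = _ := by ring
  have A2 : |∑ n ∈ S, ∑ p ∈ (Finset.univ.lcm n).primeFactors, (p : ℝ) -
      k' * (N : ℝ) ^ j * Q N| ≤ 2 * k' ^ 2 * R := by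
    refine (main_bound j N hN1).trans ?_
    rw [← hk']
    calc k' ^ 2 * (N : ℝ) ^ (j + 1) * (1 + Real.log N) ≤ k' ^ 2 * x ^ (j + 1) * (L + L) := by
          have := Real.log_natCast_nonneg N
          gcongr
      _ = 2 * k' ^ 2 * (x ^ (j + 1) * L) := by ring
      _ ≤ _ := by gcongr
  have A3 : |k' * (N : ℝ) ^ j * Q N - k' * x ^ j * Q N| ≤ k' ^ 2 * R := by
    have b0 : (N : ℝ) ^ j ≤ x ^ j := by gcongr
    have b1 : x * (x ^ j - (N : ℝ) ^ j) ≤ j * x ^ j := by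
      have t0 : (0 : ℝ) < x := by linarith
      have t := one_add_mul_le_pow (show (-2 : ℝ) ≤ -(1 / x) by
        rw [neg_le_neg_iff, div_le_iff₀ t0]; linarith) j
      have t1 : (1 + -(1 / x)) ^ j ≤ ((N : ℝ) / x) ^ j := by
        have : 1 + -(1 / x) = (x - 1) / x := by field_simp; ring
        rw [this]
        have : 0 ≤ (x - 1) / x := div_nonneg (by linarith) t0.le
        gcongr
        linarith
      rw [div_pow] at t1
      have t2 : (1 + (j : ℝ) * -(1 / x)) * x ^ j ≤ (N : ℝ) ^ j := by
        rw [← le_div_iff₀ (by positivity)]; exact t.trans t1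
      have t3 := mul_le_mul_of_nonneg_left t2 t0.le
      have t4 : x * ((1 + (j : ℝ) * -(1 / x)) * x ^ j) = x * x ^ j - j * x ^ j := by
        field_simp; ring
      rw [t4] at t3
      linarith
    have b2 : Q N ≤ x ^ 2 := (Q_le N).trans (by gcongr)
    have b3 := Q_nonneg N
    have e : |k' * (N : ℝ) ^ j * Q N - k' * x ^ j * Q N| = k' * (x ^ j - (N : ℝ) ^ j) * Q N := by
      rw [abs_sub_comm, ← sub_mul, ← mul_sub, abs_of_nonneg]
      exact mul_nonneg (mul_nonneg hk0.le (by linarith)) b3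
    rw [e]
    calc k' * (x ^ j - (N : ℝ) ^ j) * Q N ≤ k' * (x ^ j - (N : ℝ) ^ j) * x ^ 2 := by
          have : 0 ≤ x ^ j - (N : ℝ) ^ j := by linarith
          gcongr
      _ = k' * (x * (x ^ j - (N : ℝ) ^ j)) * x := by ring
      _ ≤ k' * (j * x ^ j) * x := by gcongr
      _ ≤ k' * (k' * x ^ j) * x := by
          gcongr
          rw [hk']; push_cast; linarith
      _ = k' ^ 2 * (x ^ (j + 1) * 1) := by ring
      _ ≤ k' ^ 2 * (x ^ (j + 1) * L) := by gcongr
      _ ≤ _ := by gcongr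
  have A4 : |k' * x ^ j * Q N - Real.pi ^ 2 * k' * x ^ (j + 1 + 1) / (12 * L)| ≤ k' * C * R := by
    have e : k' * x ^ j * Q N - Real.pi ^ 2 * k' * x ^ (j + 1 + 1) / (12 * L) =
        k' * x ^ j * (Q N - Real.pi ^ 2 * x ^ 2 / (12 * L)) := by ring
    rw [e, abs_mul, abs_of_nonneg (by positivity)]
    calc _ ≤ k' * x ^ j * (C * (x ^ 2 / L ^ 2)) := by gcongr
      _ = _ := by rw [hR]; ring
  set Mn := ∑ n ∈ S, ∑ p ∈ (Finset.univ.lcm n).primeFactors, (p : ℝ) with hMn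
  set T := Real.pi ^ 2 * k' * x ^ (j + 1 + 1) / (12 * L) with hT
  have A5 : |Mn - T| ≤ (3 * k' ^ 2 + k' * C) * R := by
    have a2 := abs_le.1 A2
    have a3 := abs_le.1 A3
    have a4 := abs_le.1 A4
    rw [abs_le]; constructor <;> linarith
  have A6 : ‖(Mn : ℂ) - (T : ℂ)‖ ≤ (3 * k' ^ 2 + k' * C) * R := by
    rw [← Complex.ofReal_sub, Complex.norm_real]; exact A5
  have := norm_add_le (∑ n ∈ S, f (Finset.univ.lcm n) - (Mn : ℂ)) ((Mn : ℂ) - (T : ℂ))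
  rw [sub_add_sub_cancel] at this
  rw [mul_div_assoc, ← hR]
  linarith

end LcmSum



/-- **Lcm sums for the class `F₁`** (Theorem `Th_f_additive_lcm_1`).
`F₁` is the class of additive `f : ℕ → ℂ` with `f p = p` for every prime `p` and
`|f (p^ν)| ≤ K ν^ℓ p^ν` uniformly for primes `p` and `ν ≥ 2`. For `f ∈ F₁` and
every fixed `k ≥ 1`:
`Σ_{n₁,…,n_k ≤ x} f (lcm(n₁,…,n_k)) = π² k x^{k+1}/(12 log x) + O(x^{k+1}/(log x)²)`. -/
theorem stmt_16 (f : ℕ → ℂ)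
    (hadd : ∀ m n : ℕ, Nat.Coprime m n → f (m * n) = f m + f n)
    (hp1 : ∀ p : ℕ, p.Prime → f p = (p : ℂ))
    (hbound : ∃ (l : ℕ) (K : ℝ), ∀ p : ℕ, p.Prime → ∀ ν : ℕ, 2 ≤ ν →
      ‖f (p ^ ν)‖ ≤ K * (ν : ℝ) ^ l * (p : ℝ) ^ ν)
    (k : ℕ) (hk : 1 ≤ k) :
    ∃ c > (0 : ℝ), ∃ x₀ : ℝ, 3 ≤ x₀ ∧ ∀ x ≥ x₀,
      ‖(∑ n ∈ Fintype.piFinset (fun _ : Fin k => Finset.Icc 1 ⌊x⌋₊),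
          f (Finset.univ.lcm n)) -
          ((Real.pi ^ 2 * k * x ^ (k + 1) / (12 * Real.log x) : ℝ) : ℂ)‖ ≤
        c * x ^ (k + 1) / (Real.log x) ^ 2 := by
  exact LcmSum.lcm_main f hadd hp1 hbound k hk
end
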